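/- arXiv:1508.00079 — 3 statements merged into one kernel-verified Lean document; each statement's English description precedes it below -/
import Mathlib

section
/- Petersen's 2-factor theorem: If k is even, then every k-regular graph (simple, finite) decomposes into k/2 edge-disjoint 2-factors. -/
open SimpleGraph

open Classical in
/-- A finite relation whose left degrees are at least `d` and whose right degrees are at most `d`,
with `0 < d`, contains a matching that saturates the left side. -/
theorem exists_injective_of_degree_bounds {α β : Type*} [Fintype α] [Fintype β]
    (r : α → β → Prop) (d : ℕ) (hd : 0 < d) (hl : ∀ a, d ≤ {b | r a b}.ncard)
    (hr : ∀ b, {a | r a b}.ncard ≤ d) :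
    ∃ f : α → β, Function.Injective f ∧ ∀ a, r a (f a) := by
  refine (Fintype.all_card_le_filter_rel_iff_exists_injective r).1 fun A ↦ ?_
  refine Nat.le_of_mul_le_mul_right (Finset.card_mul_le_card_mul r
    (m := d) (n := d) (fun a ha ↦ ?_) (fun b _ ↦ ?_)) hd
  · refine (hl a).trans ?_
    rw [← Set.ncard_coe_finset]
    refine Set.ncard_le_ncard (fun b hb ↦ ?_) (Set.toFinite _)
    simp only [Set.mem_ofPred_eq] at hb
    simp only [Finset.bipartiteAbove, Finset.coe_filter, Finset.mem_filter, Finset.mem_univ,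
      true_and, Set.mem_ofPred_eq]
    exact ⟨⟨a, ha, hb⟩, hb⟩
  · refine le_trans ?_ (hr b)
    rw [← Set.ncard_coe_finset]
    refine Set.ncard_le_ncard (fun a ha ↦ ?_) (Set.toFinite _)
    simp only [Finset.bipartiteBelow, Finset.coe_filter, Set.mem_ofPred_eq] at ha
    exact ha.2

/-- A finite `m`-regular relation is the disjoint union of the graphs of `m` permutations. -/
theorem exists_perm_decomposition {V : Type*} [Fintype V] (m : ℕ) (D : V → V → Prop)
    (hout : ∀ v, {w | D v w}.ncard = m) (hin : ∀ v, {w | D w v}.ncard = m) :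
    ∃ σ : Fin m → Equiv.Perm V, (∀ u v, D u v ↔ ∃ i, σ i u = v) ∧
      ∀ i j u, σ i u = σ j u → i = j := by
  induction m generalizing D with
  | zero =>
    refine ⟨fun _ ↦ 1, fun u v ↦ ⟨fun h ↦ ?_, fun ⟨i, _⟩ ↦ i.elim0⟩, fun i ↦ i.elim0⟩
    have := (Set.ncard_eq_zero (Set.toFinite _)).1 (hout u)
    exact absurd h (Set.eq_empty_iff_forall_notMem.1 this v)
  | succ m ih =>
    obtain ⟨f, hf, hD⟩ := exists_injective_of_degree_bounds D (m + 1) m.succ_pos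
      (fun v ↦ (hout v).ge) (fun v ↦ (hin v).le)
    let τ : Equiv.Perm V := Equiv.ofBijective f (Finite.injective_iff_bijective.1 hf)
    have hτ : ∀ v, D v (τ v) := hD
    obtain ⟨σ, hσ, hinj⟩ := ih (fun u v ↦ D u v ∧ τ u ≠ v)
      (fun v ↦ by
        have h : {w | D v w ∧ τ v ≠ w} = {w | D v w} \ {τ v} := by
          ext w; simp [eq_comm]
        rw [h, Set.ncard_sdiff_singleton_of_mem (s := {w | D v w}) (hτ v), hout]; rfl)
      (fun v ↦ by
        have h : {w | D w v ∧ τ w ≠ v} = {w | D w v} \ {τ.symm v} := by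
          ext w; simp [Equiv.eq_symm_apply]
        have h' : D (τ.symm v) v := by simpa using hτ (τ.symm v)
        rw [h, Set.ncard_sdiff_singleton_of_mem (s := {w | D w v}) h', hin]; rfl)
    have hne : ∀ i u, τ u ≠ σ i u := fun i u ↦ ((hσ u _).2 ⟨i, rfl⟩).2
    refine ⟨Fin.cons τ σ, fun u v ↦ ?_, fun i j u ↦ ?_⟩
    · rw [Fin.exists_fin_succ]
      simp only [Fin.cons_zero, Fin.cons_succ]
      rw [← hσ]
      by_cases h : τ u = v
      · simpa [h] using h ▸ hτ u
      · simp [h]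
    · refine Fin.cases ?_ (fun i ↦ ?_) i <;> refine Fin.cases ?_ (fun j ↦ ?_) j
      · simp
      · intro h; exact absurd h (hne j u)
      · intro h; exact absurd h.symm (hne i u)
      · intro h; exact congrArg Fin.succ (hinj i j u h)

theorem ncard_neighborSet_eq_degree {V : Type*} (G : SimpleGraph V) (v : V)
    [Fintype (G.neighborSet v)] : (G.neighborSet v).ncard = G.degree v := by
  rw [Set.ncard_eq_toFinset_card', ← G.card_neighborFinset_eq_degree, neighborFinset]

theorem mk_right_injective {V : Type*} (v : V) : Function.Injective fun w ↦ s(v, w) :=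
  fun _ _ h ↦ Sym2.congr_right.1 h

/-- A `2 * m`-regular finite graph has an orientation in which all in- and out-degrees are `m`. -/
theorem exists_balanced_orientation {V : Type*} [Fintype V] (G : SimpleGraph V) (m : ℕ)
    (hG : ∀ v, (G.neighborSet v).ncard = 2 * m) :
    ∃ D : V → V → Prop, (∀ u v, G.Adj u v ↔ D u v ∨ D v u) ∧ (∀ u v, D u v → ¬ D v u) ∧
      (∀ v, {w | D v w}.ncard = m) ∧ ∀ v, {w | D w v}.ncard = m := by
  classical
  have hdeg : ∀ v, G.degree v = 2 * m := fun v ↦ by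
    rw [← hG v, ncard_neighborSet_eq_degree]
  rcases Nat.eq_zero_or_pos m with rfl | hm
  · refine ⟨fun _ _ ↦ False, fun u v ↦ ?_, by simp, by simp, by simp⟩
    have := (Set.ncard_eq_zero (Set.toFinite _)).1 (hG u)
    simpa using Set.eq_empty_iff_forall_notMem.1 this v
  obtain ⟨f, hf, hmem⟩ := exists_injective_of_degree_bounds
    (fun (p : V × Fin m) (e : G.edgeSet) ↦ p.1 ∈ (e : Sym2 V)) (2 * m) (by omega)
    (fun p ↦ by
      have h : Subtype.val '' {e : G.edgeSet | p.1 ∈ (e : Sym2 V)} =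
          (fun w ↦ s(p.1, w)) '' G.neighborSet p.1 := by
        ext e
        simp only [Set.mem_image, Set.mem_ofPred_eq, Subtype.exists, exists_and_right,
          exists_eq_right, mem_neighborSet]
        constructor
        · rintro ⟨he, w, rfl⟩
          exact ⟨w, he, rfl⟩
        · rintro ⟨w, hw, rfl⟩
          exact ⟨hw, Sym2.mem_mk_left _ _⟩
      rw [← hG p.1, ← Set.ncard_image_of_injective _ (mk_right_injective p.1), ← h,
        Set.ncard_image_of_injective _ Subtype.val_injective])
    (fun e ↦ by
      obtain ⟨e, he⟩ := e
      induction e with | _ u v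
      have h : {p : V × Fin m | p.1 ∈ s(u, v)} = (({u, v} : Finset V) ×ˢ Finset.univ :
          Finset (V × Fin m)) := by
        ext p; simp
      rw [h, Set.ncard_coe_finset, Finset.card_product, Finset.card_fin]
      exact Nat.mul_le_mul_right m Finset.card_le_two)
  have hcard : Fintype.card (V × Fin m) = Fintype.card G.edgeSet := by
    have h := G.sum_degrees_eq_twice_card_edges
    simp only [hdeg, Finset.sum_const, Finset.card_univ, smul_eq_mul] at h
    rw [Fintype.card_prod, Fintype.card_fin, ← edgeFinset_card]
    linarith
  have hsurj : Function.Surjective f :=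
    ((Fintype.bijective_iff_injective_and_card f).2 ⟨hf, hcard⟩).2
  let D : V → V → Prop := fun u v ↦ ∃ i, (f (u, i) : Sym2 V) = s(u, v)
  have hadj : ∀ u v, G.Adj u v ↔ D u v ∨ D v u := fun u v ↦ by
    constructor
    · intro h
      obtain ⟨⟨x, i⟩, hx⟩ := hsurj ⟨s(u, v), h⟩
      have hx' : (f (x, i) : Sym2 V) = s(u, v) := congrArg Subtype.val hx
      have hxm : x ∈ (f (x, i) : Sym2 V) := hmem (x, i)
      rw [hx', Sym2.mem_iff] at hxm
      rcases hxm with rfl | rfl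
      · exact Or.inl ⟨i, hx'⟩
      · exact Or.inr ⟨i, hx'.trans Sym2.eq_swap⟩
    · rintro (⟨i, h⟩ | ⟨i, h⟩)
      · exact G.mem_edgeSet.1 (h ▸ (f (u, i)).2)
      · exact (G.mem_edgeSet.1 (h ▸ (f (v, i)).2)).symm
  have hasymm : ∀ u v, D u v → ¬ D v u := by
    rintro u v ⟨i, hi⟩ ⟨j, hj⟩
    have h := hf (Subtype.ext (hi.trans (Sym2.eq_swap.trans hj.symm)))
    exact G.ne_of_adj ((hadj u v).2 (Or.inl ⟨i, hi⟩)) (congrArg Prod.fst h)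
  have hout : ∀ v, {w | D v w}.ncard = m := fun v ↦ by
    have h : (fun w ↦ s(v, w)) '' {w | D v w} = Set.range fun i ↦ (f (v, i) : Sym2 V) := by
      ext e
      constructor
      · rintro ⟨w, ⟨i, hi⟩, rfl⟩
        exact ⟨i, hi⟩
      · rintro ⟨i, rfl⟩
        obtain ⟨w, hw⟩ : v ∈ (f (v, i) : Sym2 V) := hmem (v, i)
        exact ⟨w, ⟨i, hw⟩, hw.symm⟩
    rw [← Set.ncard_image_of_injective _ (mk_right_injective v), h, ← Set.image_univ,
      Set.ncard_image_of_injective, Set.ncard_univ, Nat.card_fin]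
    exact fun i j hij ↦ congrArg Prod.snd (hf (Subtype.ext hij))
  refine ⟨D, hadj, hasymm, hout, fun v ↦ ?_⟩
  have hunion : G.neighborSet v = {w | D v w} ∪ {w | D w v} := by
    ext w; exact hadj v w
  have h := hG v
  rw [hunion, Set.ncard_union_eq (s := {w | D v w}) (t := {w | D w v})
    (Set.disjoint_left.2 fun w ↦ hasymm v w), hout] at h
  omega

/-- The graph joining each vertex to its image under a permutation `σ` without fixed points. -/
def Equiv.Perm.toSimpleGraph {V : Type*} (σ : Equiv.Perm V) (hσ : ∀ v, σ v ≠ v) :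
    SimpleGraph V where
  Adj u v := σ u = v ∨ σ v = u
  symm := ⟨fun _ _ h ↦ h.symm⟩
  loopless := ⟨fun v h ↦ hσ v (h.elim id id)⟩

/-- Petersen's 2-factor theorem: for even `k`, every `k`-regular graph
decomposes into `k / 2` edge-disjoint 2-factors. -/
theorem stmt8 {V : Type*} [Fintype V] (G : SimpleGraph V) [DecidableRel G.Adj]
    (k : ℕ) (hk : Even k) (hreg : G.IsRegularOfDegree k) :
    ∃ f : Fin (k / 2) → SimpleGraph V,
      (∀ i, f i ≤ G ∧ ∀ v, ((f i).neighborSet v).ncard = 2) ∧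
      (∀ i j, i ≠ j → Disjoint (f i).edgeSet (f j).edgeSet) ∧
      (∀ e, e ∈ G.edgeSet ↔ ∃ i, e ∈ (f i).edgeSet) := by
  obtain ⟨D, hadj, hasymm, hout, hin⟩ := exists_balanced_orientation G (k / 2) fun v ↦ by
    rw [Nat.two_mul_div_two_of_even hk, ← hreg v, ncard_neighborSet_eq_degree]
  obtain ⟨σ, hσ, hinj⟩ := exists_perm_decomposition (k / 2) D hout hin
  have hD : ∀ i v, D v (σ i v) := fun i v ↦ (hσ v _).2 ⟨i, rfl⟩
  have hne : ∀ i v, σ i v ≠ v := fun i v ↦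
    (G.ne_of_adj ((hadj _ _).2 (Or.inl (hD i v)))).symm
  refine ⟨fun i ↦ (σ i).toSimpleGraph (hne i), fun i ↦ ⟨?_, fun v ↦ ?_⟩, fun i j hij ↦ ?_,
    fun e ↦ ?_⟩
  · rintro u v (rfl | rfl)
    · exact (hadj _ _).2 (Or.inl (hD i u))
    · exact (hadj _ _).2 (Or.inr (hD i v))
  · have h : ((σ i).toSimpleGraph (hne i)).neighborSet v = {σ i v, (σ i).symm v} := by
      ext w
      change σ i v = w ∨ σ i w = v ↔ w = σ i v ∨ w = (σ i).symm v
      rw [Equiv.eq_symm_apply, eq_comm]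
    rw [h, Set.ncard_pair]
    intro h'
    refine hasymm v (σ i v) (hD i v) ?_
    have := hD i ((σ i).symm v)
    rwa [Equiv.apply_symm_apply, ← h'] at this
  · refine Set.disjoint_left.2 fun e ↦ ?_
    induction e with | _ u v
    intro hi hj
    change σ i u = v ∨ σ i v = u at hi
    change σ j u = v ∨ σ j v = u at hj
    rcases hi with hi | hi <;> rcases hj with hj | hj
    · exact hij (hinj i j u (hi.trans hj.symm))
    · exact hasymm u v (hi ▸ hD i u) (hj ▸ hD j v)
    · exact hasymm u v (hj ▸ hD j u) (hi ▸ hD i v)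
    · exact hij (hinj i j v (hi.trans hj.symm))
  · induction e with | _ u v
    change G.Adj u v ↔ ∃ i, σ i u = v ∨ σ i v = u
    rw [hadj, hσ, hσ, exists_or]
end

section
/- If π and π − k are graphic sequences of even length, then π has a realization containing edge-disjoint subgraphs consisting of one (k−4)-factor and four perfect matchings (assuming k ≥ 4). -/
open SimpleGraph

/-- A sequence `d : Fin n → ℕ` is graphic if it is realized by a simple graph on `Fin n`. -/
def IsGraphic {n : ℕ} (d : Fin n → ℕ) : Prop :=
  ∃ G : SimpleGraph (Fin n), ∀ v, (G.neighborSet v).ncard = d v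

section Matchings

variable {V : Type*} {G : SimpleGraph V}

/-- A matching of `G`, encoded as an involution whose fixed points are the unmatched vertices. -/
def IsMatchingMap (G : SimpleGraph V) (μ : V → V) : Prop :=
  (∀ v, μ (μ v) = v) ∧ ∀ v, μ v ≠ v → G.Adj v (μ v)

open Classical in
/-- Add the edge `xy` to a matching. -/
noncomputable def addEdge (μ : V → V) (x y : V) : V → V :=
  fun v => if v = x then y else if v = y then x else μ v

open Classical in
/-- Replace the matching edge at `n` by the edge `en`. -/
noncomputable def rotateEdge (μ : V → V) (e n : V) : V → V :=
  fun v => if v = e then n else if v = n then e else if v = μ n then μ n else μ v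

theorem isMatchingMap_addEdge {μ : V → V} (h : IsMatchingMap G μ) {x y : V} (hx : μ x = x)
    (hy : μ y = y) (hxy : G.Adj x y) : IsMatchingMap G (addEdge μ x y) := by
  have h1 := h.1
  have h2 := h.2
  have h3 := hxy.symm
  constructor
  · intro v; simp only [addEdge]; grind
  · intro v; simp only [addEdge]; grind

theorem rotateEdge_eq_self_iff {μ : V → V} (h : IsMatchingMap G μ) {e n : V} (he : μ e = e)
    (hen : e ≠ n) (hn : μ n ≠ n) (v : V) :
    rotateEdge μ e n v = v ↔ v = μ n ∨ (v ≠ e ∧ μ v = v) := by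
  have h1 := h.1
  simp only [rotateEdge]
  grind

variable [Fintype V]

open Classical in
/-- The number of vertices left unmatched by `μ`. -/
noncomputable def unmatchedCard (μ : V → V) : ℕ := (Finset.univ.filter fun v => μ v = v).card

/-- A matching with the least possible number of unmatched vertices. -/
def IsMaxMatchingMap (G : SimpleGraph V) (μ : V → V) : Prop :=
  IsMatchingMap G μ ∧ ∀ ν, IsMatchingMap G ν → unmatchedCard μ ≤ unmatchedCard ν

/-- The vertices missed by some maximum matching. -/
def IsInessential (G : SimpleGraph V) (v : V) : Prop :=
  ∃ μ, IsMaxMatchingMap G μ ∧ μ v = v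

theorem unmatchedCard_addEdge_lt {μ : V → V} {x y : V} (hx : μ x = x)
    (hxy : x ≠ y) : unmatchedCard (addEdge μ x y) < unmatchedCard μ := by
  classical
  apply Finset.card_lt_card
  rw [Finset.ssubset_iff_of_subset]
  · exact ⟨x, by simp [hx], by rw [Finset.mem_filter]; simp [addEdge, hxy.symm]⟩
  · intro v
    simp only [addEdge, Finset.mem_filter, Finset.mem_univ, true_and]
    grind

/-- A maximum matching does not miss both ends of an edge. -/
theorem IsMaxMatchingMap.not_adj {μ : V → V} (h : IsMaxMatchingMap G μ) {x y : V} (hx : μ x = x)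
    (hy : μ y = y) : ¬ G.Adj x y := fun hxy =>
  absurd (h.2 _ (isMatchingMap_addEdge h.1 hx hy hxy))
    (not_le.2 (unmatchedCard_addEdge_lt hx hxy.ne))

theorem unmatchedCard_rotateEdge {μ : V → V} (h : IsMatchingMap G μ) {e n : V} (he : μ e = e)
    (hen : e ≠ n) (hn : μ n ≠ n) : unmatchedCard (rotateEdge μ e n) = unmatchedCard μ := by
  classical
  have h1 := h.1
  unfold unmatchedCard
  apply Finset.card_bij' (fun v _ => if v = μ n then e else v) (fun v _ => if v = e then μ n else v)
  all_goals
    intro v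
    simp only [Finset.mem_filter, Finset.mem_univ, true_and, rotateEdge_eq_self_iff h he hen hn]
    grind

theorem IsMaxMatchingMap.rotateEdge {μ : V → V} (h : IsMaxMatchingMap G μ) {e n : V}
    (he : μ e = e) (hen : G.Adj e n) : IsMaxMatchingMap G (rotateEdge μ e n) := by
  have hn : μ n ≠ n := fun hn => h.not_adj he hn hen
  have h1 := h.1.1
  have h2 := h.1.2
  have h3 := hen.symm
  have h4 := hen.ne
  refine ⟨⟨?_, ?_⟩, ?_⟩
  · intro v; simp only [_root_.rotateEdge]; grind
  · intro v; simp only [_root_.rotateEdge]; grind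
  · rw [unmatchedCard_rotateEdge h.1 he h4 hn]
    exact h.2

open Classical in
theorem card_rotateEdge_ne_lt {μ ν : V → V} (hμ : IsMatchingMap G μ) (hν : IsMatchingMap G ν)
    {y : V} (hy : μ y = y) (hνy : ν y ≠ y) :
    (Finset.univ.filter fun v => rotateEdge μ y (ν y) v ≠ ν v).card <
      (Finset.univ.filter fun v => μ v ≠ ν v).card := by
  have h1 := hμ.1
  have h2 := hν.1
  apply Finset.card_lt_card
  rw [Finset.ssubset_iff_of_subset]
  · exact ⟨y, by simp [hy, hνy.symm], by rw [Finset.mem_filter]; simp [rotateEdge]⟩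
  · intro v
    simp only [rotateEdge, Finset.mem_filter, Finset.mem_univ, true_and]
    grind

/-- A maximum matching `ν` can be changed, using edges of the maximum matching `μ` only, so as
to miss a given vertex missed by `μ` in place of one of the vertices missed by `ν`. -/
theorem IsMaxMatchingMap.exists_exchange {μ ν : V → V} (hμ : IsMaxMatchingMap G μ)
    (hν : IsMaxMatchingMap G ν) {y : V} (hy : μ y = y) :
    ∃ ν' s, IsMaxMatchingMap G ν' ∧ ν s = s ∧ (ν y = y → s = y) ∧
      (∀ v, ν' v = v ↔ v = y ∨ (v ≠ s ∧ ν v = v)) ∧ ∀ v, ν' v = ν v ∨ ν' v = μ v := by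
  classical
  induction hk : (Finset.univ.filter fun v => μ v ≠ ν v).card using Nat.strong_induction_on
    generalizing μ y with
  | _ k ih =>
  by_cases hνy : ν y = y
  · exact ⟨ν, y, hν, hνy, fun _ => rfl, by grind, fun v => Or.inl rfl⟩
  have hadj : G.Adj y (ν y) := hν.1.2 y hνy
  have hn : μ (ν y) ≠ ν y := fun hn => hμ.not_adj hy hn hadj
  have h1 := hμ.1.1
  have h2 := hν.1.1
  have h4 := hadj.ne
  have hrot := hμ.rotateEdge hy hadj
  obtain ⟨ν', s, hν', hs, hs', hfix, hpt⟩ := ih _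
    (hk ▸ card_rotateEdge_ne_lt hμ.1 hν.1 hy hνy) hrot
    ((rotateEdge_eq_self_iff hμ.1 hy h4 hn _).2 (Or.inl rfl)) rfl
  have h3 := hν'.1.1
  have hy' : ν' y = ν y := by
    have := hpt y
    simpa [_root_.rotateEdge] using this
  have hadj' : G.Adj (μ (ν y)) (ν y) := (hμ.1.2 _ hn).symm
  have hfy : ν' (μ (ν y)) = μ (ν y) := (hfix _).2 (Or.inl rfl)
  have hn' : ν' (ν y) ≠ ν y := fun hn' => hν'.not_adj hfy hn' hadj'
  refine ⟨_root_.rotateEdge ν' (μ (ν y)) (ν y), s, hν'.rotateEdge hfy hadj', hs, by grind, ?_, ?_⟩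
  · intro v
    rw [rotateEdge_eq_self_iff hν'.1 hfy hadj'.ne hn', hfix]
    grind
  · intro v
    have := hpt v
    simp only [_root_.rotateEdge] at this ⊢
    grind

/-- If some maximum matching misses `v` and `w`, and `v'` is an inessential neighbour of `v`,
then some maximum matching misses `v'` and `w`. -/
theorem exists_isMaxMatchingMap_of_adj {v v' w : V} (hadj : G.Adj v v') (hv' : IsInessential G v')
    (h : ∃ μ, IsMaxMatchingMap G μ ∧ μ v = v ∧ μ w = w ∧ v ≠ w) :
    ∃ μ, IsMaxMatchingMap G μ ∧ μ v' = v' ∧ μ w = w ∧ v' ≠ w := by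
  obtain ⟨μ, hμ, hv, hw, hvw⟩ := h
  obtain ⟨ν, hν, hνv⟩ := hv'
  obtain ⟨μ', s, hμ', hs, -, hfix, -⟩ := hν.exists_exchange hμ hνv
  have h1 : μ' v' = v' := (hfix _).2 (Or.inl rfl)
  have h2 : μ' v ≠ v := fun h => hμ'.not_adj h h1 hadj
  have h3 : ¬ μ v' = v' := fun h => hμ.not_adj hv h hadj
  exact ⟨μ', hμ', h1, by grind, by grind⟩

/-- Walking along an alternating path from `x` to `y`, both of whose parities consist of
inessential vertices, a proper 2-colouring takes the same value at both ends. -/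
theorem eq_of_alternating {φ : V → Bool} {Q : V → Prop}
    (hQ : ∀ p q, Q p → IsInessential G q → G.Adj p q → Q q ∧ φ p ≠ φ q)
    {μ ν l : V → V} (hμ : IsMaxMatchingMap G μ) (hν : IsMaxMatchingMap G ν)
    (hl : IsMaxMatchingMap G l) {x y : V} (hx : Q x) (hμx : μ x = x) (hνx : ν x ≠ x)
    (hfix : ∀ v, ν v = v → μ v ≠ v → v = y) (hlx : l (ν x) = ν x)
    (hlν : ∀ v, μ v ≠ ν v → v ≠ x → v ≠ ν x → v ≠ y → l v = ν v) : φ x = φ y := by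
  classical
  induction hk : (Finset.univ.filter fun v => μ v ≠ ν v).card using Nat.strong_induction_on
    generalizing μ l x with
  | _ k ih =>
  have hadj : G.Adj x (ν x) := hν.1.2 x hνx
  have hn : μ (ν x) ≠ ν x := fun hn => hμ.not_adj hμx hn hadj
  have h1 := hμ.1.1
  have h2 := hν.1.1
  have h3 := hl.1.1
  have hrot := hμ.rotateEdge hμx hadj
  have hfixrot := rotateEdge_eq_self_iff hμ.1 hμx hadj.ne hn
  obtain ⟨hQ1, hφ1⟩ := hQ _ _ hx ⟨l, hl, hlx⟩ hadj
  have hadj' : G.Adj (ν x) (μ (ν x)) := hμ.1.2 _ hn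
  have hrotfix := (hfixrot (μ (ν x))).2 (Or.inl rfl)
  obtain ⟨hQ2, hφ2⟩ := hQ _ _ hQ1 ⟨_, hrot, hrotfix⟩ hadj'
  have hφ : φ x = φ (μ (ν x)) := by
    revert hφ1 hφ2
    cases φ x <;> cases φ (ν x) <;> cases φ (μ (ν x)) <;> simp
  rw [hφ]
  by_cases hy : μ (ν x) = y
  · rw [hy]
  have hl2 : l (μ (ν x)) = ν (μ (ν x)) := hlν _ (by grind) (by grind) (by grind) hy
  have hl2' : l (μ (ν x)) ≠ μ (ν x) := fun h => hl.not_adj hlx h hadj'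
  refine ih _ (hk ▸ card_rotateEdge_ne_lt hμ.1 hν.1 hμx hνx) hrot (hl.rotateEdge hlx hadj')
    hQ2 hrotfix (by grind) (by grind) ?_ ?_ rfl
  · rw [rotateEdge_eq_self_iff hl.1 hlx hadj'.ne hl2']
    exact Or.inl hl2.symm
  · intro v hv
    simp only [_root_.rotateEdge] at hv ⊢
    have := hlν v
    grind

/-- A component of the inessential vertices with at least one edge is not bipartite. -/
theorem exists_adj_eq_color {Q : V → Prop}
    (hQ : ∀ p q, Q p → IsInessential G q → G.Adj p q → Q q) {x y : V} (hx : Q x)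
    (hxD : IsInessential G x) (hyD : IsInessential G y) (hxy : G.Adj x y) (φ : V → Bool) :
    ∃ p q, Q p ∧ Q q ∧ G.Adj p q ∧ φ p = φ q := by
  by_contra! hφ
  obtain ⟨μ, hμ, hμx⟩ := hxD
  obtain ⟨m, hm, hmy⟩ := hyD
  obtain ⟨ν, s, hν, -, -, hfix, -⟩ := hm.exists_exchange hμ hmy
  have hνy : ν y = y := (hfix y).2 (Or.inl rfl)
  have hνx : ν x ≠ x := fun h => hν.not_adj h hνy hxy
  have h2 := hν.1.1
  have hy : Q y := hQ x y hx ⟨m, hm, hmy⟩ hxy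
  refine hφ x y hx hy hxy (eq_of_alternating (Q := Q) (fun p q hp hq hpq => ?_) hμ hν
    (hν.rotateEdge hνy hxy.symm) hx hμx hνx (by grind) ?_ ?_)
  · exact ⟨hQ p q hp hq hpq, hφ p q hp (hQ p q hp hq hpq) hpq⟩
  · rw [rotateEdge_eq_self_iff hν.1 hνy hxy.ne.symm hνx]
    exact Or.inl rfl
  · intro v
    simp only [rotateEdge]
    grind

theorem exists_isMaxMatchingMap (G : SimpleGraph V) : ∃ μ, IsMaxMatchingMap G μ := by
  classical
  obtain ⟨μ, hμ, h⟩ := Finset.exists_min_image (Finset.univ.filter (IsMatchingMap G))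
    unmatchedCard ⟨id, by simp [IsMatchingMap]⟩
  exact ⟨μ, (Finset.mem_filter.1 hμ).2, fun ν hν => h ν (by simpa using hν)⟩

open Classical in
/-- In a regular graph, a set of vertices is not larger than its neighbourhood. -/
theorem card_le_card_of_adj {h : ℕ} (hh : 1 ≤ h)
    (hreg : ∀ v, (Finset.univ.filter fun t => G.Adj v t).card = h) {R S : Finset V}
    (hRS : ∀ e ∈ R, ∀ t, G.Adj e t → t ∈ S) : R.card ≤ S.card := by
  have key := Finset.card_mul_le_card_mul (s := R) (t := S) (m := h) (n := h) G.Adj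
    (fun e he => by
      rw [← hreg e]
      apply Finset.card_le_card
      intro t
      simp only [Finset.mem_filter, Finset.mem_univ, true_and, Finset.bipartiteAbove]
      exact fun ht => ⟨hRS e he t ht, ht⟩)
    (fun t _ => by
      rw [← hreg t]
      apply Finset.card_le_card
      intro e
      simp only [Finset.mem_filter, Finset.mem_univ, true_and, Finset.bipartiteBelow]
      exact fun he => he.2.symm)
  exact Nat.le_of_mul_le_mul_right key hh

open Classical in
/-- A regular graph has a maximum matching such that every missed vertex has an inessential
neighbour. -/
theorem exists_isMaxMatchingMap_forall_adj {h : ℕ} (hh : 1 ≤ h)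
    (hreg : ∀ v, (Finset.univ.filter fun t => G.Adj v t).card = h) :
    ∃ μ, IsMaxMatchingMap G μ ∧ ∀ v, μ v = v → ∃ t, G.Adj v t ∧ IsInessential G t := by
  let I : V → Prop := fun v => ∀ t, G.Adj v t → ¬ IsInessential G t
  let F : (V → V) → Finset V := fun μ => Finset.univ.filter fun v => μ v = v ∧ I v
  obtain ⟨μ₀, hμ₀⟩ := exists_isMaxMatchingMap G
  obtain ⟨μ, hμ, hmin⟩ := Finset.exists_min_image (Finset.univ.filter (IsMaxMatchingMap G))
    (fun μ => (F μ).card) ⟨μ₀, by simpa using hμ₀⟩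
  replace hμ : IsMaxMatchingMap G μ := (Finset.mem_filter.1 hμ).2
  refine ⟨μ, hμ, fun x hx => ?_⟩
  by_contra! hxI
  let P : Finset V → Prop := fun R => x ∈ R ∧ ∀ e ∈ R, (e = x ∨ μ e ≠ e) ∧
    ∃ m, IsMaxMatchingMap G m ∧
    (∀ v, m v = v ↔ v = e ∨ (v ≠ x ∧ μ v = v)) ∧ ∀ v, v ∉ R → μ v ∉ R → m v = μ v
  obtain ⟨R, hR, hmax⟩ := Finset.exists_max_image (Finset.univ.filter P) Finset.card
    ⟨{x}, by
      simp only [P, Finset.mem_filter, Finset.mem_univ, true_and, Finset.mem_singleton]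
      rintro e rfl
      exact ⟨Or.inl rfl, μ, hμ, by grind, fun _ _ _ => rfl⟩⟩
  obtain ⟨hxR, hR⟩ : P R := (Finset.mem_filter.1 hR).2
  have h1 := hμ.1.1
  have hRI : ∀ e ∈ R, I e := by
    intro e he
    obtain ⟨-, m, hm, hfix, -⟩ := hR e he
    by_contra hI
    refine absurd (hmin m (by simpa using hm)) (not_le.2 (Finset.card_lt_card ?_))
    rw [Finset.ssubset_iff_of_subset]
    · refine ⟨x, by simpa [F, hx] using hxI, ?_⟩
      simp only [F, Finset.mem_filter, hfix]
      grind
    · intro v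
      simp only [F, Finset.mem_filter, hfix]
      grind
  have hRD : ∀ e ∈ R, IsInessential G e := fun e he => by
    obtain ⟨-, m, hm, hfix, -⟩ := hR e he
    exact ⟨m, hm, (hfix e).2 (Or.inl rfl)⟩
  have hclosed : ∀ e ∈ R, ∀ n, G.Adj e n → μ n ∈ R := by
    intro e he n hen
    by_contra hnR
    have hnD : ¬ IsInessential G n := hRI e he n hen
    have hnn : μ n ≠ n := fun hn => hnD ⟨μ, hμ, hn⟩
    have hnR' : n ∉ R := fun h => hnD (hRD n h)
    have : P (insert (μ n) R) := by
      refine ⟨by simp [hxR], fun e' he' => ?_⟩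
      rcases Finset.mem_insert.1 he' with rfl | he'
      · obtain ⟨hex, m, hm, hfix, hag⟩ := hR e he
        have hme : m e = e := (hfix e).2 (Or.inl rfl)
        have hmn : m n = μ n := hag n hnR' hnR
        refine ⟨Or.inr (by grind), _, hm.rotateEdge hme hen, fun v => ?_, fun v hv hv' => ?_⟩
        · rw [rotateEdge_eq_self_iff hm.1 hme hen.ne (by rw [hmn]; exact hnn), hfix, hmn]
          grind
        · have := hag v
          simp only [rotateEdge]
          grind
      · obtain ⟨hex, m, hm, hfix, hag⟩ := hR e' he'
        exact ⟨hex, m, hm, hfix, fun v hv hv' => hag v (by grind) (by grind)⟩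
    have := hmax _ (by simpa using this)
    rw [Finset.card_insert_of_notMem hnR] at this
    omega
  have hcard := card_le_card_of_adj (S := (R.erase x).image μ) hh hreg (fun e he n hen => by
    refine Finset.mem_image.2 ⟨μ n, Finset.mem_erase.2 ⟨?_, hclosed e he n hen⟩, h1 n⟩
    intro hnx
    have : n = x := by rw [← h1 n, hnx, hx]
    exact hRI e he n hen (this ▸ ⟨μ, hμ, hx⟩))
  have h2 := hcard.trans Finset.card_image_le
  rw [Finset.card_erase_of_mem hxR] at h2
  have : 0 < R.card := Finset.card_pos.2 ⟨x, hxR⟩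
  omega

open Classical in
/-- In a regular graph of even order without a perfect matching there are two non-bipartite sets
of vertices such that any two vertices of different sets are missed by a maximum matching. -/
theorem exists_nonbipartite_pair {h : ℕ} (hh : 1 ≤ h)
    (hreg : ∀ v, (Finset.univ.filter fun t => G.Adj v t).card = h) (heven : Even (Fintype.card V))
    (hno : ∀ μ, IsMatchingMap G μ → ∃ v, μ v = v) :
    ∃ Q₁ Q₂ : V → Prop,
      (∀ v w, Q₁ v → Q₂ w → ∃ μ, IsMaxMatchingMap G μ ∧ μ v = v ∧ μ w = w ∧ v ≠ w) ∧
      (∀ φ : V → Bool, ∃ p q, Q₁ p ∧ Q₁ q ∧ G.Adj p q ∧ φ p = φ q) ∧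
      ∀ φ : V → Bool, ∃ p q, Q₂ p ∧ Q₂ q ∧ G.Adj p q ∧ φ p = φ q := by
  obtain ⟨μ, hμ, hadj⟩ := exists_isMaxMatchingMap_forall_adj hh hreg
  obtain ⟨x, hx⟩ := hno μ hμ.1
  obtain ⟨w, hwx, hw⟩ : ∃ w, w ≠ x ∧ μ w = w := by
    have : Fact (Nat.Prime 2) := ⟨Nat.prime_two⟩
    obtain ⟨w, hw, hwx⟩ := Equiv.Perm.exists_fixed_point_of_prime' (p := 2) (n := 1)
      (σ := Function.Involutive.toPerm μ hμ.1.1) (a := x) heven.two_dvd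
      (by ext v; rw [pow_one, sq]; exact hμ.1.1 v) hx
    exact ⟨w, hwx, hw⟩
  let r : V → V → Prop := fun p q => G.Adj p q ∧ IsInessential G q
  obtain ⟨x', hxx', hx'⟩ := hadj x hx
  obtain ⟨w', hww', hw'⟩ := hadj w hw
  refine ⟨Relation.ReflTransGen r x, Relation.ReflTransGen r w, ?_, ?_, ?_⟩
  · intro v v' hv hv'
    have h1 : ∃ μ, IsMaxMatchingMap G μ ∧ μ v = v ∧ μ w = w ∧ v ≠ w := by
      induction hv with
      | refl => exact ⟨μ, hμ, hx, hw, hwx.symm⟩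
      | tail _ h ih => exact exists_isMaxMatchingMap_of_adj h.1 h.2 ih
    have h2 : ∃ μ, IsMaxMatchingMap G μ ∧ μ v' = v' ∧ μ v = v ∧ v' ≠ v := by
      induction hv' with
      | refl =>
        obtain ⟨m, hm, hv, hw, hne⟩ := h1
        exact ⟨m, hm, hw, hv, hne.symm⟩
      | tail _ h ih => exact exists_isMaxMatchingMap_of_adj h.1 h.2 ih
    obtain ⟨m, hm, hv, hw, hne⟩ := h2
    exact ⟨m, hm, hw, hv, hne.symm⟩
  · exact exists_adj_eq_color (fun p q hp hq hpq => hp.tail ⟨hpq, hq⟩) .refl ⟨μ, hμ, hx⟩ hx' hxx'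
  · exact exists_adj_eq_color (fun p q hp hq hpq => hp.tail ⟨hpq, hq⟩) .refl ⟨μ, hμ, hw⟩ hw' hww'

end Matchings

section Colorings

variable {V K : Type*}

/-- A symmetric edge colouring of the complete graph, the diagonal having a fixed colour. -/
def IsEdgeColoring (c : V → V → K) (o : K) : Prop :=
  (∀ u v, c u v = c v u) ∧ ∀ v, c v v = o

open Classical in
/-- Interchange the rows of `u` and `w` (and the columns, symmetrically) on the set `T`. -/
noncomputable def swapRows (c : V → V → K) (u w : V) (T : Finset V) : V → V → K := fun p q =>
  if p ∈ T then c p (Equiv.swap u w q)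
  else if q ∈ T then c (Equiv.swap u w p) q else c p q

open Classical in
theorem isEdgeColoring_swapRows {c : V → V → K} {o : K} (hc : IsEdgeColoring c o) {u w : V}
    {T : Finset V} (hu : u ∉ T) (hw : w ∉ T) : IsEdgeColoring (swapRows c u w T) o := by
  have h1 := hc.1
  have h2 := hc.2
  constructor
  · intro p q
    simp only [swapRows, Equiv.swap_apply_def]
    grind
  · intro p
    simp only [swapRows, Equiv.swap_apply_def]
    grind

variable [Fintype V]

open Classical in
/-- The number of entries of colour `a` in the row of `v`. -/
noncomputable def colorDegree (c : V → V → K) (v : V) (a : K) : ℕ :=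
  (Finset.univ.filter fun t => c v t = a).card

theorem colorDegree_eq_card {c : V → V → K} {v : V} {a : K} {S : Finset V}
    (h : ∀ t, c v t = a ↔ t ∈ S) : colorDegree c v a = S.card := by
  rw [colorDegree]
  congr 1
  ext t
  simp [h]

theorem colorDegree_eq_card_add_card {c : V → V → K} {v : V} {a : K} {S T : Finset V}
    (h : ∀ t, c v t = a ↔ t ∈ S ∨ t ∈ T) (hST : Disjoint S T) :
    colorDegree c v a = S.card + T.card := by
  classical
  rw [← Finset.card_union_of_disjoint hST]
  exact colorDegree_eq_card (by simpa using h)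

theorem colorDegree_eq_zero_iff {c : V → V → K} {v : V} {a : K} :
    colorDegree c v a = 0 ↔ ∀ t, c v t ≠ a := by
  simp [colorDegree, Finset.filter_eq_empty_iff]

open Classical in
theorem colorDegree_swapRows {c : V → V → K} {u w : V}
    {T : Finset V} (hu : u ∉ T) (hw : w ∉ T)
    (hT : ∀ a, (T.filter fun t => c u t = a).card = (T.filter fun t => c w t = a).card)
    (v : V) (a : K) : colorDegree (swapRows c u w T) v a = colorDegree c v a := by
  by_cases hv : v ∈ T
  · simp only [colorDegree, swapRows, hv, if_true]
    refine Finset.card_equiv (Equiv.swap u w) fun t => ?_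
    simp
  have split : ∀ f : V → K, (Finset.univ.filter fun t => f t = a).card =
      (T.filter fun t => f t = a).card + (Tᶜ.filter fun t => f t = a).card := fun f => by
    rw [← Finset.card_union_of_disjoint, ← Finset.filter_union, Finset.union_compl]
    exact Finset.disjoint_filter_filter disjoint_compl_right
  have hc : (Tᶜ.filter fun t => swapRows c u w T v t = a) = Tᶜ.filter fun t => c v t = a := by
    refine Finset.filter_congr fun t ht => ?_
    rw [Finset.mem_compl] at ht
    simp [swapRows, hv, ht]
  have hc' : (T.filter fun t => swapRows c u w T v t = a) =
      T.filter fun t => c (Equiv.swap u w v) t = a := by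
    refine Finset.filter_congr fun t ht => ?_
    simp [swapRows, hv, ht]
  rw [colorDegree, colorDegree, split, split, hc, hc']
  congr 1
  by_cases h1 : v = u
  · subst h1; simp [hT]
  by_cases h2 : v = w
  · subst h2; simp [hT]
  rw [Equiv.swap_apply_of_ne_of_ne h1 h2]

open Classical in
/-- If `f` takes values in each set of colours containing `a` but not `b` at least as often as
`g`, an element `x` with `f x = b` and `g x = a` extends to a set on which `f` and `g` have the
same distribution. -/
theorem exists_balanced_set [Fintype K] {f g : V → K} {U : Finset V} {a b : K} {x : V}
    (hx : x ∈ U) (hfx : f x = b) (hgx : g x = a) (hab : a ≠ b)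
    (hbal : ∀ R : Finset K, a ∈ R → b ∉ R →
      (U.filter fun t => g t ∈ R).card ≤ (U.filter fun t => f t ∈ R).card) :
    ∃ T ⊆ U, x ∈ T ∧ (∀ t ∈ T, f t = b → t = x) ∧
      ∀ d, (T.filter fun t => f t = d).card = (T.filter fun t => g t = d).card := by
  let P : Finset K → Prop := fun R => a ∈ R ∧ b ∉ R ∧ ∀ e ∈ R, ∃ T ⊆ U,
    (∀ t ∈ T, f t ∈ R ∧ f t ≠ e) ∧
    ∀ d, (T.filter fun t => f t = d).card + (if d = e then 1 else 0) =
      (T.filter fun t => g t = d).card + (if d = a then 1 else 0)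
  obtain ⟨R, hR, hmax⟩ := Finset.exists_max_image (Finset.univ.filter P) Finset.card
    ⟨{a}, by
      simp only [P, Finset.mem_filter, Finset.mem_univ, true_and, Finset.mem_singleton]
      refine ⟨hab.symm, ?_⟩
      rintro e rfl
      exact ⟨∅, by simp, by simp, by simp⟩⟩
  obtain ⟨haR, hbR, hR⟩ : P R := (Finset.mem_filter.1 hR).2
  obtain ⟨t, htU, hft, hgt⟩ : ∃ t ∈ U, f t ∈ R ∧ g t ∉ R := by
    by_contra! h
    refine absurd (hbal R haR hbR) (not_le.2 (Finset.card_lt_card ?_))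
    rw [Finset.ssubset_iff_of_subset]
    · exact ⟨x, by simp [hx, hgx, haR], by simp [hfx, hbR]⟩
    · intro t ht
      rw [Finset.mem_filter] at ht ⊢
      exact ⟨ht.1, h t ht.1 ht.2⟩
  obtain ⟨T, hTU, hTR, hT⟩ := hR _ hft
  have htT : t ∉ T := fun h => (hTR t h).2 rfl
  have hT' : ∀ d, ((insert t T).filter fun t => f t = d).card + (if d = g t then 1 else 0) =
      ((insert t T).filter fun t => g t = d).card + (if d = a then 1 else 0) := by
    intro d
    have := hT d
    rw [Finset.filter_insert, Finset.filter_insert]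
    have h1 : t ∉ T.filter fun t => f t = d := by simp [htT]
    have h2 : t ∉ T.filter fun t => g t = d := by simp [htT]
    split_ifs <;> grind
  by_cases hgb : g t = b
  · have hxT : x ∉ insert t T := by
      intro h
      rcases Finset.mem_insert.1 h with rfl | h
      · exact hbR (hfx ▸ hft)
      · exact hbR (hfx ▸ (hTR x h).1)
    refine ⟨insert x (insert t T), by grind, by simp, ?_, fun d => ?_⟩
    · intro s hs hsb
      by_contra hsx
      have : f s ∈ R := by grind
      exact hbR (hsb ▸ this)
    · have := hT' d
      rw [Finset.filter_insert, Finset.filter_insert (a := x)]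
      have h1 : x ∉ (insert t T).filter fun t => f t = d := by
        rw [Finset.mem_filter]; exact fun h => hxT h.1
      have h2 : x ∉ (insert t T).filter fun t => g t = d := by
        rw [Finset.mem_filter]; exact fun h => hxT h.1
      split_ifs <;> grind
  · have : P (insert (g t) R) := by
      refine ⟨by simp [haR], by grind, fun e he => ?_⟩
      rcases Finset.mem_insert.1 he with rfl | he
      · exact ⟨insert t T, by grind, by grind, hT'⟩
      · obtain ⟨T', h1, h2, h3⟩ := hR e he
        exact ⟨T', h1, by grind, h3⟩
    have := hmax _ (by simpa using this)
    rw [Finset.card_insert_of_notMem hgt] at this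
    omega

open Classical in
theorem card_filter_mem_eq_sum (c : V → V → K) (v : V) (R : Finset K) :
    (Finset.univ.filter fun t => c v t ∈ R).card = ∑ b ∈ R, colorDegree c v b := by
  rw [Finset.card_eq_sum_card_fiberwise (f := c v) (t := R) (fun t ht => by simpa using ht)]
  refine Finset.sum_congr rfl fun b hb => ?_
  rw [colorDegree, Finset.filter_filter]
  congr 1
  ext t
  simp only [Finset.mem_filter, Finset.mem_univ, true_and]
  grind

open Classical in
theorem card_filter_mem_le [Fintype K] {c : V → V → K} {u w : V} {a a' : K}
    (hdeg : ∀ b, b ≠ a → b ≠ a' → colorDegree c u b = colorDegree c w b)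
    (ha : colorDegree c w a ≤ colorDegree c u a) {R : Finset K} (haR : a ∈ R) :
    (Finset.univ.filter fun t => c w t ∈ R).card ≤
      (Finset.univ.filter fun t => c u t ∈ R).card := by
  by_cases ha' : a' ∈ R
  · have h : ∀ v, (Finset.univ.filter fun t => c v t ∈ R).card +
        (Finset.univ.filter fun t => c v t ∈ Rᶜ).card = Fintype.card V := fun v => by
      simp only [Finset.mem_compl]
      exact Finset.card_filter_add_card_filter_not _
    have h1 : (Finset.univ.filter fun t => c u t ∈ Rᶜ).card =
        (Finset.univ.filter fun t => c w t ∈ Rᶜ).card := by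
      rw [card_filter_mem_eq_sum, card_filter_mem_eq_sum]
      refine Finset.sum_congr rfl fun b hb => ?_
      rw [Finset.mem_compl] at hb
      exact hdeg b (fun h => hb (h ▸ haR)) fun h => hb (h ▸ ha')
    have := h u
    have := h w
    omega
  · rw [card_filter_mem_eq_sum, card_filter_mem_eq_sum]
    refine Finset.sum_le_sum fun b hb => ?_
    by_cases hba : b = a
    · rwa [hba]
    · exact (hdeg b hba (by grind)).ge

open Classical in
/-- A set of columns on which the rows of `u` and `w` can be interchanged without changing any
colour degree, moving one given edge of colour `b` from `u` to `w`. -/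
theorem exists_swap_set [Fintype K] {c : V → V → K} {o : K} (hc : IsEdgeColoring c o) {u w x : V}
    {a a' b : K} (hdeg : ∀ b, b ≠ a → b ≠ a' → colorDegree c u b = colorDegree c w b)
    (ha : colorDegree c w a ≤ colorDegree c u a) (hux : c u x = b) (hwx : c w x = a)
    (hab : a ≠ b) (hxu : x ≠ u) (hxw : x ≠ w) :
    ∃ T : Finset V, u ∉ T ∧ w ∉ T ∧ x ∈ T ∧ (∀ t ∈ T, c u t = b → t = x) ∧
      ∀ d, (T.filter fun t => c u t = d).card = (T.filter fun t => c w t = d).card := by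
  have huw : u ≠ w := fun h => hab (by rw [← hwx, ← hux, h])
  obtain ⟨T, hTU, hxT, hT, hT'⟩ := exists_balanced_set (f := c u) (g := c w)
    (U := (Finset.univ.erase u).erase w) (x := x) (by simp [hxu, hxw]) hux hwx hab (by
      intro R haR _
      have h : ∀ v, (Finset.univ.filter fun t => c v t ∈ R).card =
          (((Finset.univ.erase u).erase w).filter fun t => c v t ∈ R).card +
            ((if c v u ∈ R then 1 else 0) + (if c v w ∈ R then 1 else 0)) := fun v => by
        simp only [Finset.card_filter]
        rw [← Finset.add_sum_erase _ _ (Finset.mem_univ u), ← Finset.add_sum_erase _ _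
          (show w ∈ Finset.univ.erase u by simp [huw.symm])]
        omega
      have h1 := h u
      have h2 := h w
      have h3 := card_filter_mem_le hdeg ha haR
      rw [hc.2 u, hc.1 u w] at h1
      rw [hc.2 w] at h2
      omega)
  exact ⟨T, fun h => by simpa using hTU h, fun h => by simpa using hTU h, hxT, hT, hT'⟩

end Colorings

section Improvement

variable {V K : Type*}

/-- The graph of the edges of colour `b`. -/
def colorGraph (c : V → V → K) (b : K) : SimpleGraph V where
  Adj u v := u ≠ v ∧ c u v = b ∧ c v u = b
  symm := ⟨fun _ _ h => ⟨h.1.symm, h.2.2, h.2.1⟩⟩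
  loopless := ⟨fun _ h => h.1 rfl⟩

theorem colorGraph_adj {c : V → V → K} {o b : K} (hc : IsEdgeColoring c o) (hb : b ≠ o) {u v : V} :
    (colorGraph c b).Adj u v ↔ c u v = b := by
  refine ⟨fun h => h.2.1, fun h => ⟨?_, h, hc.1 u v ▸ h⟩⟩
  rintro rfl
  exact hb (h ▸ hc.2 u)

theorem disjoint_colorGraph {c : V → V → K} {a b : K} (hab : a ≠ b) :
    Disjoint (colorGraph c a) (colorGraph c b) := by
  rw [disjoint_iff_inf_le]
  exact fun u v h => hab (h.1.2.1.symm.trans h.2.2.1)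

open Classical in
theorem isMatchingMap_addEdge_swapRows {c : V → V → K} {o b : K} (hc : IsEdgeColoring c o)
    (hb : b ≠ o) {μ : V → V} (hμ : IsMatchingMap (colorGraph c b) μ) {u w x : V} {T : Finset V}
    (hx : μ x = x) (hw : μ w = w) (hux : c u x = b) (huT : u ∉ T) (hwT : w ∉ T)
    (hxT : x ∈ T) (hT : ∀ t ∈ T, c u t = b → t = x) :
    IsMatchingMap (colorGraph (swapRows c u w T) b) (addEdge μ x w) := by
  have hc' := isEdgeColoring_swapRows hc huT hwT
  refine isMatchingMap_addEdge ⟨hμ.1, fun v hv => ?_⟩ hx hw ?_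
  · have h1 := (colorGraph_adj hc hb).1 (hμ.2 v hv)
    have h2 := hμ.1
    have h3 := hc.1
    rw [colorGraph_adj hc' hb]
    simp only [swapRows, Equiv.swap_apply_def]
    grind
  · rw [colorGraph_adj hc' hb]
    simp only [swapRows, hxT, if_true, Equiv.swap_apply_right]
    rw [hc.1, hux]

variable [Fintype V]

theorem ncard_neighborSet_colorGraph {c : V → V → K} {o b : K}
    (hc : IsEdgeColoring c o) (hb : b ≠ o) (v : V) :
    ((colorGraph c b).neighborSet v).ncard = colorDegree c v b := by
  classical
  rw [colorDegree, ← Set.ncard_coe_finset]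
  congr 1
  ext t
  simp [colorGraph_adj hc hb]

/-- Among all colourings with the same colour degrees, `c` has a largest matching in colour `b`. -/
def IsBestColoring (c : V → V → K) (o b : K) : Prop :=
  IsEdgeColoring c o ∧ ∀ μ, IsMaxMatchingMap (colorGraph c b) μ → ∀ c' ν, IsEdgeColoring c' o →
    (∀ v a, colorDegree c' v a = colorDegree c v a) → IsMatchingMap (colorGraph c' b) ν →
      unmatchedCard μ ≤ unmatchedCard ν

theorem exists_isBestColoring {c : V → V → K} {o : K} (hc : IsEdgeColoring c o) (b : K) :
    ∃ c', IsBestColoring c' o b ∧ ∀ v a, colorDegree c' v a = colorDegree c v a := by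
  classical
  have hne : ∃ n c' μ, IsEdgeColoring c' o ∧ (∀ v a, colorDegree c' v a = colorDegree c v a) ∧
      IsMatchingMap (colorGraph c' b) μ ∧ unmatchedCard μ = n :=
    ⟨_, c, id, hc, fun _ _ => rfl, ⟨fun _ => rfl, fun v hv => absurd rfl hv⟩, rfl⟩
  obtain ⟨c', μ, hc', hdeg, hμ, hn⟩ := Nat.find_spec hne
  refine ⟨c', ⟨hc', fun μ' hμ' d ν hd hdeg' hν => ?_⟩, hdeg⟩
  refine (hμ'.2 μ hμ).trans (hn ▸ Nat.find_min' hne ⟨d, ν, hd, fun v a => ?_, hν, rfl⟩)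
  rw [hdeg', hdeg]

variable {c : V → V → K} {o b : K} {μ : V → V} {u w x : V}

open Classical in
theorem IsBestColoring.false_of_balanced (hc : IsBestColoring c o b) (hb : b ≠ o)
    (hμ : IsMaxMatchingMap (colorGraph c b) μ) {T : Finset V}
    (hx : μ x = x) (hw : μ w = w) (hux : c u x = b) (huT : u ∉ T) (hwT : w ∉ T)
    (hxT : x ∈ T) (hT : ∀ t ∈ T, c u t = b → t = x)
    (hbal : ∀ a, (T.filter fun t => c u t = a).card = (T.filter fun t => c w t = a).card) :
    False :=
  absurd (hc.2 μ hμ _ _ (isEdgeColoring_swapRows hc.1 huT hwT) (colorDegree_swapRows huT hwT hbal)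
    (isMatchingMap_addEdge_swapRows hc.1 hb hμ.1 hx hw hux huT hwT hxT hT))
    (not_le.2 (unmatchedCard_addEdge_lt hx fun h => hwT (h ▸ hxT)))

theorem IsBestColoring.ne_of_colorDegree_le [Fintype K] (hc : IsBestColoring c o b) (hb : b ≠ o)
    (hμ : IsMaxMatchingMap (colorGraph c b) μ) (hx : μ x = x) (hw : μ w = w) (hxw : x ≠ w)
    (hux : c u x = b) {a a' : K} (hab : a ≠ b)
    (hdeg : ∀ e, e ≠ a → e ≠ a' → colorDegree c u e = colorDegree c w e)
    (ha : colorDegree c w a ≤ colorDegree c u a) : c w x ≠ a := by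
  intro hwx
  obtain ⟨T, huT, hwT, hxT, hT, hbal⟩ := exists_swap_set hc.1 hdeg ha hux hwx hab
    (fun h => hb (by rw [← hux, h, hc.1.2])) hxw
  exact hc.false_of_balanced hb hμ hx hw hux huT hwT hxT hT hbal

theorem IsBestColoring.ne_of_alternating (hc : IsBestColoring c o b) (hb : b ≠ o)
    (hμ : IsMaxMatchingMap (colorGraph c b) μ) (hx : μ x = x) (hw : μ w = w) (hxw : x ≠ w)
    (hux : c u x = b) {i : K} (hib : i ≠ b) (hio : i ≠ o) {v : V} (huv : c u v = i)
    (hwv : c w v = b) : c w x ≠ i := by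
  classical
  intro hwx
  have h := hc.1.2
  have hvx : x ≠ v := by grind
  refine hc.false_of_balanced hb hμ (T := {x, v}) hx hw hux (by grind) (by grind) (by simp)
    (by grind) fun a => ?_
  simp only [Finset.card_filter, Finset.sum_pair hvx, hux, huv, hwx, hwv]
  omega

theorem eq_of_colorDegree_le_one {v s t : V} {i : K} (h : colorDegree c v i ≤ 1) (hs : c v s = i)
    (ht : c v t = i) : s = t := by
  classical
  exact Finset.card_le_one.1 h s (by simpa using hs) t (by simpa using ht)

open Classical in
theorem sum_colorDegree [Fintype K] (c : V → V → K) (v : V) :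
    ∑ a, colorDegree c v a = Fintype.card V := by
  rw [← card_filter_mem_eq_sum]
  simp

end Improvement

section Threshold

variable {V : Type*} {G : SimpleGraph V}

theorem false_of_forall_edge_min_le {Q : V → Prop}
    (hQ : ∀ φ : V → Bool, ∃ p q, Q p ∧ Q q ∧ G.Adj p q ∧ φ p = φ q) (d : V → ℕ) (m : ℕ)
    (hle : ∀ p q, Q p → Q q → G.Adj p q → min (d p) (d q) ≤ m)
    (hlt : ∀ p q, Q p → Q q → G.Adj p q → m < max (d p) (d q)) : False := by
  obtain ⟨p, q, hp, hq, hpq, h⟩ := hQ fun v => decide (d v ≤ m)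
  have h1 := hle p q hp hq hpq
  have h2 := hlt p q hp hq hpq
  have h3 : d p ≤ m ↔ d q ≤ m := by simpa using h
  omega

theorem exists_edge_max_min [Finite V] {Q : V → Prop}
    (hQ : ∀ φ : V → Bool, ∃ p q, Q p ∧ Q q ∧ G.Adj p q ∧ φ p = φ q) (d : V → ℕ) :
    ∃ a b, Q a ∧ Q b ∧ G.Adj a b ∧
      ∀ p q, Q p → Q q → G.Adj p q → min (d p) (d q) ≤ min (d a) (d b) := by
  obtain ⟨p, q, hp, hq, hpq, -⟩ := hQ fun _ => true
  obtain ⟨e, he, hmax⟩ := Set.exists_max_image {e : V × V | Q e.1 ∧ Q e.2 ∧ G.Adj e.1 e.2}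
    (fun e => min (d e.1) (d e.2)) (Set.toFinite _) ⟨(p, q), hp, hq, hpq⟩
  exact ⟨e.1, e.2, he.1, he.2.1, he.2.2, fun p q hp hq hpq => hmax (p, q) ⟨hp, hq, hpq⟩⟩

theorem false_of_nonbipartite_pair [Finite V] {Q₁ Q₂ : V → Prop} (d : V → ℕ)
    (h₁ : ∀ φ : V → Bool, ∃ p q, Q₁ p ∧ Q₁ q ∧ G.Adj p q ∧ φ p = φ q)
    (h₂ : ∀ φ : V → Bool, ∃ p q, Q₂ p ∧ Q₂ q ∧ G.Adj p q ∧ φ p = φ q)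
    (h₁₂ : ∀ a b w v, Q₁ a → Q₁ b → G.Adj a b → Q₂ w → Q₂ v → G.Adj w v →
      min (d a) (d b) < max (d w) (d v))
    (h₂₁ : ∀ a b w v, Q₂ a → Q₂ b → G.Adj a b → Q₁ w → Q₁ v → G.Adj w v →
      min (d a) (d b) < max (d w) (d v)) : False := by
  obtain ⟨a, b, ha, hb, hab, h⟩ := exists_edge_max_min h₁ d
  obtain ⟨a', b', ha', hb', hab', h'⟩ := exists_edge_max_min h₂ d
  rcases le_total (min (d a) (d b)) (min (d a') (d b')) with hle | hle
  · exact false_of_forall_edge_min_le h₁ d _ (fun p q hp hq hpq => (h p q hp hq hpq).trans hle)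
      fun p q => h₂₁ a' b' p q ha' hb' hab'
  · exact false_of_forall_edge_min_le h₂ d _ (fun p q hp hq hpq => (h' p q hp hq hpq).trans hle)
      fun p q => h₁₂ a b p q ha hb hab

end Threshold

section SevenColors

variable {V : Type*} [Fintype V] {c : V → V → Fin 7}

/-- Colour degrees as in a graph with edges of colours other than `1` in which the edges of colour
`2` form a regular graph of degree `h` and the colours from `3` onwards are `m` perfect
matchings. -/
def HasFactors (c : V → V → Fin 7) (h m : ℕ) : Prop :=
  IsEdgeColoring c 1 ∧ (∀ v, colorDegree c v 2 = h) ∧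
    ∀ v, ∀ i : Fin 7, 3 ≤ i.val → colorDegree c v i = if i.val < 3 + m then 1 else 0

theorem HasFactors.colorDegree_eq {h m : ℕ} (hc : HasFactors c h m) (u v : V) {e : Fin 7}
    (h0 : e ≠ 0) (h1 : e ≠ 1) : colorDegree c u e = colorDegree c v e := by
  by_cases h2 : e = 2
  · rw [h2, hc.2.1, hc.2.1]
  · have : 3 ≤ e.val := by omega
    rw [hc.2.2 _ _ this, hc.2.2 _ _ this]

theorem HasFactors.colorDegree_le_one {h m : ℕ} (hc : HasFactors c h m) (v : V) {i : Fin 7}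
    (hi : 3 ≤ i.val) : colorDegree c v i ≤ 1 := by
  rw [hc.2.2 v i hi]
  split_ifs <;> simp

theorem HasFactors.colorDegree_one_le {h m : ℕ} (hc : HasFactors c h m) {u v : V}
    (hle : colorDegree c u 0 ≤ colorDegree c v 0) : colorDegree c v 1 ≤ colorDegree c u 1 := by
  have h1 := sum_colorDegree c u
  have h2 := sum_colorDegree c v
  simp only [Fin.sum_univ_seven] at h1 h2
  have h3 := hc.colorDegree_eq u v (e := 2) (by decide) (by decide)
  have h4 := hc.colorDegree_eq u v (e := 3) (by decide) (by decide)
  have h5 := hc.colorDegree_eq u v (e := 4) (by decide) (by decide)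
  have h6 := hc.colorDegree_eq u v (e := 5) (by decide) (by decide)
  have h7 := hc.colorDegree_eq u v (e := 6) (by decide) (by decide)
  omega

theorem HasFactors.three_le_color {h m : ℕ} (hm : m ≤ 3) (hf : HasFactors c h m)
    (hc : IsBestColoring c 1 2) {p p' q q' : V}
    (hmiss : ∃ μ, IsMaxMatchingMap (colorGraph c 2) μ ∧ μ p = p ∧ μ q = q ∧ p ≠ q)
    (hp : c p' p = 2) (hq : c q' q = 2) (h1 : colorDegree c q 0 ≤ colorDegree c p' 0)
    (h2 : colorDegree c q' 0 ≤ colorDegree c p 0) : 3 ≤ (c p q).val ∧ (c p q).val < 6 := by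
  obtain ⟨μ, hμ, hμp, hμq, hpq⟩ := hmiss
  have h01 : c p q ≠ 0 := by
    rw [hf.1.1]
    exact hc.ne_of_colorDegree_le (by decide) hμ hμp hμq hpq hp (a' := 1) (by decide)
      (fun e he he' => hf.colorDegree_eq _ _ he he') h1
  have h11 : c p q ≠ 1 := hc.ne_of_colorDegree_le (by decide) hμ hμq hμp hpq.symm hq (a' := 0)
    (by decide) (fun e he he' => hf.colorDegree_eq _ _ he' he) (hf.colorDegree_one_le h2)
  have h21 : c p q ≠ 2 := fun h =>
    hμ.not_adj hμp hμq ((colorGraph_adj hf.1 (by decide)).2 h)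
  have h61 : c p q ≠ 6 := fun h => by
    have h6 : colorDegree c p 6 = 0 := by
      rw [hf.2.2 p 6 (by decide), if_neg]
      change ¬ 6 < 3 + m
      omega
    exact colorDegree_eq_zero_iff.1 h6 q h
  omega

theorem HasFactors.min_lt_max {h m : ℕ} (hm : m ≤ 3) (hf : HasFactors c h m)
    (hc : IsBestColoring c 1 2) {Q₁ Q₂ : V → Prop}
    (hmiss : ∀ v w, Q₁ v → Q₂ w →
      ∃ μ, IsMaxMatchingMap (colorGraph c 2) μ ∧ μ v = v ∧ μ w = w ∧ v ≠ w)
    {a b w v : V} (ha : Q₁ a) (hb : Q₁ b) (hab : (colorGraph c 2).Adj a b) (hw : Q₂ w) (hv : Q₂ v)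
    (hwv : (colorGraph c 2).Adj w v) :
    min (colorDegree c a 0) (colorDegree c b 0) < max (colorDegree c w 0) (colorDegree c v 0) := by
  by_contra! hle
  obtain ⟨h1, h2, h3, h4⟩ : colorDegree c w 0 ≤ colorDegree c a 0 ∧
      colorDegree c w 0 ≤ colorDegree c b 0 ∧ colorDegree c v 0 ≤ colorDegree c a 0 ∧
      colorDegree c v 0 ≤ colorDegree c b 0 := by omega
  have haw := hf.three_le_color hm hc (hmiss a w ha hw) hab.2.2 hwv.2.2 h2 h3
  have hav := hf.three_le_color hm hc (hmiss a v ha hv) hab.2.2 hwv.2.1 h4 h1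
  have hbw := hf.three_le_color hm hc (hmiss b w hb hw) hab.2.1 hwv.2.2 h1 h4
  have hbv := hf.three_le_color hm hc (hmiss b v hb hv) hab.2.1 hwv.2.1 h3 h2
  have alt : ∀ {p p'}, Q₁ p → c p' p = 2 → 3 ≤ (c p' v).val → c p w ≠ c p' v := by
    intro p p' hp hpp h3
    obtain ⟨μ, hμ, hμp, hμw, hne⟩ := hmiss p w hp hw
    rw [hf.1.1 p]
    exact hc.ne_of_alternating (by decide) hμ hμp hμw hne hpp (by omega) (by omega) rfl hwv.2.1
  have n1 : c a w ≠ c b v := alt ha hab.2.2 hbv.1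
  have n2 : c b w ≠ c a v := alt hb hab.2.1 hav.1
  have n3 : c a w ≠ c a v := fun h =>
    hwv.1 (eq_of_colorDegree_le_one (hf.colorDegree_le_one a hav.1) h rfl)
  have n4 : c b w ≠ c b v := fun h =>
    hwv.1 (eq_of_colorDegree_le_one (hf.colorDegree_le_one b hbv.1) h rfl)
  have n5 : c a w ≠ c b w := fun h => by
    rw [hf.1.1 a, hf.1.1 b] at h
    rw [hf.1.1] at hbw
    exact hab.1 (eq_of_colorDegree_le_one (hf.colorDegree_le_one w hbw.1) h rfl)
  have n6 : c a v ≠ c b v := fun h => by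
    rw [hf.1.1 a, hf.1.1 b] at h
    rw [hf.1.1] at hbv
    exact hab.1 (eq_of_colorDegree_le_one (hf.colorDegree_le_one v hbv.1) h rfl)
  omega

theorem HasFactors.exists_perfect_matching {h m : ℕ} (hf : HasFactors c h m)
    (heven : Even (Fintype.card V)) (hh : 1 ≤ h) (hm : m ≤ 3) :
    ∃ c' μ, HasFactors c' h m ∧ (∀ v, colorDegree c' v 0 = colorDegree c v 0) ∧
      IsMatchingMap (colorGraph c' 2) μ ∧ ∀ v, μ v ≠ v := by
  classical
  obtain ⟨c', hc', hdeg⟩ := exists_isBestColoring hf.1 2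
  have hf' : HasFactors c' h m :=
    ⟨hc'.1, fun v => by rw [hdeg, hf.2.1], fun v i hi => by rw [hdeg, hf.2.2 v i hi]⟩
  by_contra! hno
  obtain ⟨Q₁, Q₂, hmiss, h₁, h₂⟩ := exists_nonbipartite_pair (G := colorGraph c' 2) hh
    (fun v => by
      rw [← hf'.2.1 v, colorDegree]
      congr 1
      ext t
      simp [colorGraph_adj hc'.1])
    heven fun μ hμ => hno c' μ hf' (fun v => hdeg v 0) hμ
  refine false_of_nonbipartite_pair (fun v => colorDegree c' v 0) h₁ h₂
    (fun a b w v ha hb hab hw hv hwv => hf'.min_lt_max hm hc' hmiss ha hb hab hw hv hwv)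
    fun a b w v ha hb hab hw hv hwv => hf'.min_lt_max hm hc' (fun v w hv hw => ?_)
      ha hb hab hw hv hwv
  obtain ⟨μ, h1, h2, h3, h4⟩ := hmiss w v hw hv
  exact ⟨μ, h1, h3, h2, h4.symm⟩

theorem HasFactors.succ {h m : ℕ} (hf : HasFactors c (h + 1) m)
    (heven : Even (Fintype.card V)) (hm : m ≤ 3) :
    ∃ c', HasFactors c' h (m + 1) ∧ ∀ v, colorDegree c' v 0 = colorDegree c v 0 := by
  classical
  obtain ⟨c', μ, hc', hdeg, hμ, hfix⟩ := hf.exists_perfect_matching heven (by omega) hm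
  obtain ⟨j, hj⟩ : ∃ j : Fin 7, j.val = 3 + m := ⟨⟨3 + m, by omega⟩, rfl⟩
  have hμ2 : ∀ v, c' v (μ v) = 2 := fun v => (hμ.2 v (hfix v)).2.1
  have hμμ := hμ.1
  have hnj : ∀ v t, c' v t ≠ j := fun v => colorDegree_eq_zero_iff.1 <| by
    rw [hc'.2.2 v j (by omega), if_neg (by omega)]
  have hdeg' : ∀ v a, a ≠ 2 → a ≠ j →
      colorDegree (fun u v => if v = μ u then j else c' u v) v a = colorDegree c' v a := by
    intro v a h2 hj
    unfold colorDegree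
    congr 1
    ext t
    simp only [Finset.mem_filter, Finset.mem_univ, true_and]
    have := hμ2 v
    grind
  refine ⟨fun u v => if v = μ u then j else c' u v, ⟨⟨fun u v => ?_, fun v => ?_⟩, fun v => ?_,
    fun v i hi => ?_⟩, fun v => ?_⟩
  · have := hc'.1.1 u v
    have : v = μ u ↔ u = μ v := by grind
    grind
  · have := hc'.1.2 v
    have := hfix v
    grind
  · have h1 := hc'.2.1 v
    rw [colorDegree_eq_card (S := Finset.univ.filter fun t => c' v t = 2) (by simp)] at h1
    rw [colorDegree_eq_card (S := (Finset.univ.filter fun t => c' v t = 2).erase (μ v)),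
      Finset.card_erase_of_mem (by simpa using hμ2 v), h1, Nat.add_sub_cancel]
    intro t
    simp only [Finset.mem_filter, Finset.mem_univ, true_and, Finset.mem_erase]
    have : j ≠ 2 := by omega
    grind
  · by_cases hij : i = j
    · subst hij
      rw [if_pos (by omega), colorDegree, Finset.card_eq_one]
      refine ⟨μ v, ?_⟩
      ext t
      have := hnj v t
      simp only [Finset.mem_filter, Finset.mem_univ, true_and, Finset.mem_singleton]
      grind
    · rw [hdeg' v i (by omega) hij, hc'.2.2 v i hi]
      congr 1
      have : i.val ≠ j.val := fun h => hij (Fin.ext h)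
      rw [eq_iff_iff]
      omega
  · rw [hdeg' v 0 (by decide) (by omega), hdeg]

theorem HasFactors.exists_four {h : ℕ} (hf : HasFactors c (h + 4) 0)
    (heven : Even (Fintype.card V)) :
    ∃ c', HasFactors c' h 4 ∧ ∀ v, colorDegree c' v 0 = colorDegree c v 0 := by
  obtain ⟨c₁, hf₁, h₁⟩ := hf.succ heven (by simp)
  obtain ⟨c₂, hf₂, h₂⟩ := hf₁.succ heven (by simp)
  obtain ⟨c₃, hf₃, h₃⟩ := hf₂.succ heven (by simp)
  obtain ⟨c₄, hf₄, h₄⟩ := hf₃.succ heven (by simp)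
  exact ⟨c₄, hf₄, fun v => by rw [h₄, h₃, h₂, h₁]⟩

theorem HasFactors.sum_colorDegree_compl {h : ℕ} (hf : HasFactors c h 4) (v : V) :
    ∑ a ∈ {1}ᶜ, colorDegree c v a = colorDegree c v 0 + h + 4 := by
  have hm : ∀ i : Fin 7, 3 ≤ i.val → colorDegree c v i = 1 := fun i hi => by
    rw [hf.2.2 v i hi, if_pos i.isLt]
  rw [show ({1}ᶜ : Finset (Fin 7)) = {0, 2, 3, 4, 5, 6} by decide]
  simp [hf.2.1, hm]
  omega

end SevenColors

section Kundu

variable {V : Type*} [Fintype V]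

open Classical in
theorem colorDegree_swapRows_pair {K : Type*} {c : V → V → K} {p q u y : V} {a b : K} (hpu : p ≠ u)
    (hpy : p ≠ y) (hqu : q ≠ u) (hqy : q ≠ y) (huy : u ≠ y) (h1 : c p u = a) (h2 : c q u = b)
    (h3 : c p y = b) (h4 : c q y = a) (v : V) (e : K) :
    colorDegree (swapRows c p q {u, y}) v e = colorDegree c v e := by
  refine colorDegree_swapRows (by simp [hpu, hpy]) (by simp [hqu, hqy]) (fun a => ?_) v e
  simp only [Finset.card_filter, Finset.sum_pair huy, h1, h2, h3, h4]
  omega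

open Classical in
/-- The number of ordered pairs that are edges of `g'` but not of `g`. -/
noncomputable def excessCard (g g' : V → V → Bool) : ℕ :=
  (Finset.univ.filter fun e : V × V => g' e.1 e.2 = true ∧ g e.1 e.2 = false).card

open Classical in
theorem exists_excessCard_lt {g g' : V → V → Bool} (hg : IsEdgeColoring g false)
    (hg' : IsEdgeColoring g' false) {u v x y : V} (huv : g' u v = true ∧ g u v = false)
    (hux : g u x = true ∧ g' u x = false) (hvy : g v y = true ∧ g' v y = false) (hxy : x ≠ y)
    (hyx : ¬ (g y x = true ∧ g' y x = false)) :
    ∃ f f', IsEdgeColoring f false ∧ IsEdgeColoring f' false ∧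
      (∀ t e, colorDegree f t e = colorDegree g t e) ∧
      (∀ t e, colorDegree f' t e = colorDegree g' t e) ∧ excessCard f f' < excessCard g g' := by
  have hs := hg.1
  have hs' := hg'.1
  have hd := hg.2
  have hd' := hg'.2
  have n1 : u ≠ v := by rintro rfl; simp [hd'] at huv
  have n2 : u ≠ x := by rintro rfl; simp [hd] at hux
  have n3 : v ≠ y := by rintro rfl; simp [hd] at hvy
  have n4 : u ≠ y := by rintro rfl; rw [hs, huv.2] at hvy; simp at hvy
  have hlt : ∀ f f', (∀ p q, f' p q = true → f p q = false → g' p q = true ∧ g p q = false) →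
      (f' u v = false ∨ f u v = true) → excessCard f f' < excessCard g g' := by
    intro f f' h1 h2
    apply Finset.card_lt_card
    rw [Finset.ssubset_iff_of_subset]
    · refine ⟨(u, v), by simpa using huv, ?_⟩
      simp only [Finset.mem_filter, Finset.mem_univ, true_and]
      grind
    · intro e he
      simp only [Finset.mem_filter, Finset.mem_univ, true_and] at he ⊢
      exact h1 _ _ he.1 he.2
  by_cases hxy' : g y x = true
  · have h5 : g' y x = true := by simpa [hxy'] using hyx
    refine ⟨g, swapRows g' v x {u, y}, hg,
      isEdgeColoring_swapRows hg' (by simp [n1.symm, n3]) (by simp [n2.symm, hxy]), fun _ _ => rfl,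
      colorDegree_swapRows_pair (a := true) (b := false) n1.symm n3 n2.symm hxy n4 ?_ ?_ ?_ ?_,
      hlt _ _ (fun p q => ?_) ?_⟩
    · rw [hs', huv.1]
    · rw [hs', hux.2]
    · exact hvy.2
    · rw [hs', h5]
    all_goals
      clear hlt hg hg'
      simp only [swapRows, Equiv.swap_apply_def, Finset.mem_insert, Finset.mem_singleton]
      grind
  · refine ⟨swapRows g v x {u, y}, g',
      isEdgeColoring_swapRows hg (by simp [n1.symm, n3]) (by simp [n2.symm, hxy]), hg',
      colorDegree_swapRows_pair (a := false) (b := true) n1.symm n3 n2.symm hxy n4 ?_ ?_ ?_ ?_,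
      fun _ _ => rfl, hlt _ _ (fun p q => ?_) ?_⟩
    · rw [hs, huv.2]
    · rw [hs, hux.1]
    · exact hvy.1
    · rw [hs]; simpa using hxy'
    all_goals
      clear hlt hg hg'
      simp only [swapRows, Equiv.swap_apply_def, Finset.mem_insert, Finset.mem_singleton]
      grind

open Classical in
/-- **Kundu's theorem** for Boolean adjacency matrices. -/
theorem exists_le_of_colorDegree {g₀ g₀' : V → V → Bool} (hg₀ : IsEdgeColoring g₀ false)
    (hg₀' : IsEdgeColoring g₀' false) {k : ℕ} (hk : 1 ≤ k)
    (hdeg₀ : ∀ v, colorDegree g₀ v true = colorDegree g₀' v true + k) :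
    ∃ g g', IsEdgeColoring g false ∧ IsEdgeColoring g' false ∧
      (∀ v, colorDegree g v true = colorDegree g₀ v true) ∧
      (∀ v, colorDegree g' v true = colorDegree g₀' v true) ∧
      ∀ u v, g' u v = true → g u v = true := by
  have hne : ∃ n g g', IsEdgeColoring g false ∧ IsEdgeColoring g' false ∧
      (∀ v, colorDegree g v true = colorDegree g₀ v true) ∧
      (∀ v, colorDegree g' v true = colorDegree g₀' v true) ∧ excessCard g g' = n :=
    ⟨_, g₀, g₀', hg₀, hg₀', fun _ => rfl, fun _ => rfl, rfl⟩
  obtain ⟨g, g', hg, hg', hdeg, hdeg', hn⟩ := Nat.find_spec hne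
  have hmin := fun g g' h1 h2 h3 h4 => hn.trans_le (Nat.find_min' hne ⟨g, g', h1, h2, h3, h4, rfl⟩)
  clear hn
  refine ⟨g, g', hg, hg', hdeg, hdeg', ?_⟩
  obtain ⟨hs, hd⟩ := hg
  obtain ⟨hs', hd'⟩ := hg'
  let B : V → Finset V := fun v => Finset.univ.filter fun t => g v t = true ∧ g' v t = false
  let R : V → Finset V := fun v => Finset.univ.filter fun t => g' v t = true ∧ g v t = false
  have hB : ∀ v t, t ∈ B v ↔ g v t = true ∧ g' v t = false := fun v t => by simp [B]
  have hR : ∀ v t, t ∈ R v ↔ g' v t = true ∧ g v t = false := fun v t => by simp [R]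
  have hBR : ∀ v, (B v).card = (R v).card + k := by
    intro v
    have h1 : colorDegree g v true =
        (Finset.univ.filter fun t => g v t = true ∧ g' v t = true).card + (B v).card :=
      colorDegree_eq_card_add_card (by grind) (by rw [Finset.disjoint_left]; grind)
    have h2 : colorDegree g' v true =
        (Finset.univ.filter fun t => g v t = true ∧ g' v t = true).card + (R v).card :=
      colorDegree_eq_card_add_card (by grind) (by rw [Finset.disjoint_left]; grind)
    have h3 := hdeg v
    have h4 := hdeg' v
    have h5 := hdeg₀ v
    omega
  have key : ∀ u v x y, v ∈ R u → x ∈ B u → y ∈ B v → x ≠ y → x ∈ B y := by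
    intro u v x y huv hux hvy hxy
    by_contra hne
    rw [hB] at *
    rw [hR] at huv
    obtain ⟨f, f', hf, hf', h1, h2, h⟩ :=
      exists_excessCard_lt ⟨hs, hd⟩ ⟨hs', hd'⟩ huv hux hvy hxy hne
    exact absurd (hmin f f' hf hf' (fun t => by rw [h1, hdeg]) fun t => by rw [h2, hdeg'])
      (not_le.2 h)
  by_contra! hex
  obtain ⟨u₀, v₀, h1, h2⟩ := hex
  obtain ⟨u, hu, hmax⟩ := Finset.exists_max_image
    (Finset.univ.filter fun u => (R u).Nonempty) (fun u => (B u).card)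
    ⟨u₀, by simpa using ⟨v₀, (hR _ _).2 ⟨h1, by simpa using h2⟩⟩⟩
  obtain ⟨v, hv⟩ := (Finset.mem_filter.1 hu).2
  obtain ⟨y, hy⟩ : (B v).Nonempty := Finset.card_pos.1 (by have := hBR v; omega)
  have hvu : v ∉ B u := by have := hR u v; have := hB u v; grind
  have huB : u ∉ B u := by have := hB u u; have := hd u; grind
  have hvy : v ∈ B y := by have := hB y v; have := hB v y; have := hs v y; have := hs' v y; grind
  have hcard : (B u).card + 1 ≤ (B y).card := by
    by_cases hyu : y ∈ B u
    · have huy : u ∈ B y := by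
        have := hB y u; have := hB u y; have := hs u y; have := hs' u y; grind
      have huv : u ≠ v := by rintro rfl; have := hR u u; have := hd' u; grind
      have hsub : insert v (insert u ((B u).erase y)) ⊆ B y := by
        intro t ht
        have := key u v t y hv
        grind
      have h3 := Finset.card_le_card hsub
      rw [Finset.card_insert_of_notMem (by grind), Finset.card_insert_of_notMem (by grind),
        Finset.card_erase_of_mem hyu] at h3
      have := Finset.card_pos.2 ⟨y, hyu⟩
      omega
    · rw [← Finset.card_insert_of_notMem hvu]
      refine Finset.card_le_card fun t ht => ?_
      have := key u v t y hv
      grind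
  have h3 := hBR u
  have h4 := hBR y
  have := hmax y (by simpa using Finset.card_pos.1 (by omega))
  omega

end Kundu

open Classical in
theorem exists_isEdgeColoring_of_isGraphic {n : ℕ} {d : Fin n → ℕ} (hd : IsGraphic d) :
    ∃ g : Fin n → Fin n → Bool, IsEdgeColoring g false ∧ ∀ v, colorDegree g v true = d v := by
  obtain ⟨G, hG⟩ := hd
  refine ⟨fun u v => decide (G.Adj u v), ⟨fun u v => by simp [G.adj_comm], by simp⟩, fun v => ?_⟩
  rw [← hG v, colorDegree, ← Set.ncard_coe_finset]
  congr 1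
  ext t
  simp

open Classical in
theorem exists_hasFactors {n : ℕ} {d : Fin n → ℕ} {k : ℕ} (hk : 1 ≤ k) (hdk : ∀ i, k ≤ d i)
    (hd : IsGraphic d) (hd' : IsGraphic (fun i => d i - k)) :
    ∃ c : Fin n → Fin n → Fin 7, HasFactors c k 0 ∧ ∀ v, colorDegree c v 0 = d v - k := by
  obtain ⟨g₀, hg₀, hdeg₀⟩ := exists_isEdgeColoring_of_isGraphic hd
  obtain ⟨g₀', hg₀', hdeg₀'⟩ := exists_isEdgeColoring_of_isGraphic hd'
  obtain ⟨g, g', hg, hg', hdeg, hdeg', hle⟩ := exists_le_of_colorDegree hg₀ hg₀' hk fun v => by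
    rw [hdeg₀, hdeg₀', Nat.sub_add_cancel (hdk v)]
  have h0 : ∀ v, colorDegree
      (fun u v => if g' u v then (0 : Fin 7) else if g u v then 2 else 1) v 0 = d v - k := by
    intro v
    rw [← hdeg₀', ← hdeg', colorDegree, colorDegree]
    congr 1
    ext t
    simp only [Finset.mem_filter, Finset.mem_univ, true_and]
    split_ifs <;> simp_all
  refine ⟨fun u v => if g' u v then 0 else if g u v then 2 else 1, ⟨⟨fun u v => ?_, fun v => ?_⟩,
    fun v => ?_, fun v i hi => ?_⟩, h0⟩
  · simp only [hg.1 u v, hg'.1 u v]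
  · simp [hg.2, hg'.2]
  · have h : colorDegree g v true = _ + _ :=
      colorDegree_eq_card_add_card (S := Finset.univ.filter fun t => g' v t = true)
        (T := Finset.univ.filter fun t => g v t = true ∧ g' v t = false)
        (fun t => by have := hle v t; grind) (by rw [Finset.disjoint_left]; grind)
    rw [← colorDegree_eq_card (c := g') (a := true) (v := v) (by simp), hdeg, hdeg', hdeg₀,
      hdeg₀'] at h
    rw [colorDegree_eq_card (S := Finset.univ.filter fun t => g v t = true ∧ g' v t = false)
      fun t => by grind]
    have := hdk v
    omega
  · rw [if_neg (by omega), colorDegree_eq_zero_iff]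
    intro t
    split_ifs <;> omega

/-- If `π` and `π - k` are graphic of even length (and `k ≥ 4`), then `π`
has a realization containing edge-disjoint copies of one `(k-4)`-factor and four
perfect matchings. -/
theorem stmt10 {n : ℕ} (hn : Even n) (d : Fin n → ℕ) (k : ℕ) (hk : 4 ≤ k)
    (hdk : ∀ i, k ≤ d i)
    (hd : IsGraphic d) (hd' : IsGraphic (fun i => d i - k)) :
    ∃ G : SimpleGraph (Fin n), (∀ v, (G.neighborSet v).ncard = d v) ∧
      ∃ H M₁ M₂ M₃ M₄ : SimpleGraph (Fin n),
        H ≤ G ∧ M₁ ≤ G ∧ M₂ ≤ G ∧ M₃ ≤ G ∧ M₄ ≤ G ∧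
        (∀ v, (H.neighborSet v).ncard = k - 4) ∧
        (∀ v, (M₁.neighborSet v).ncard = 1) ∧
        (∀ v, (M₂.neighborSet v).ncard = 1) ∧
        (∀ v, (M₃.neighborSet v).ncard = 1) ∧
        (∀ v, (M₄.neighborSet v).ncard = 1) ∧
        List.Pairwise (fun A B => Disjoint A.edgeSet B.edgeSet) [H, M₁, M₂, M₃, M₄] := by
  obtain ⟨c₀, hc₀, hdeg₀⟩ := exists_hasFactors (by omega) hdk hd hd'
  obtain ⟨h, rfl⟩ := Nat.exists_eq_add_of_le' hk
  obtain ⟨c, hc, hdeg⟩ := hc₀.exists_four (by simpa using hn)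
  have hle : ∀ a, a ≠ 1 → colorGraph c a ≤ (colorGraph c 1)ᶜ := by
    refine fun a ha u v huv => ⟨huv.1, fun h => ha (huv.2.1.symm.trans h.2.1)⟩
  have hmatch : ∀ i : Fin 7, 3 ≤ i.val → ∀ v, ((colorGraph c i).neighborSet v).ncard = 1 := by
    intro i hi v
    rw [ncard_neighborSet_colorGraph hc.1 (by omega), hc.2.2 v i hi, if_pos i.isLt]
  refine ⟨(colorGraph c 1)ᶜ, fun v => ?_, colorGraph c 2, colorGraph c 3, colorGraph c 4,
    colorGraph c 5, colorGraph c 6, hle _ (by decide), hle _ (by decide), hle _ (by decide),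
    hle _ (by decide), hle _ (by decide), fun v => ?_, hmatch _ (by decide), hmatch _ (by decide),
    hmatch _ (by decide), hmatch _ (by decide), ?_⟩
  · classical
    have h1 := hc.sum_colorDegree_compl v
    rw [← card_filter_mem_eq_sum, hdeg, hdeg₀, ← Set.ncard_coe_finset] at h1
    have h2 := hdk v
    trans d v - (h + 4) + h + 4
    · rw [← h1]
      congr 1
      ext t
      have h3 := hc.1.1 v t
      have h4 := hc.1.2 v
      simp [colorGraph]
      grind
    · omega
  · rw [ncard_neighborSet_colorGraph hc.1 (by decide), hc.2.1, Nat.add_sub_cancel]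
  · simp [disjoint_colorGraph]
end

section
/- If π and π − k are graphic sequences of even length, then π has a realization containing ⌊k/2⌋ + 2 pairwise edge-disjoint perfect matchings (assuming k ≥ 4). -/
open SimpleGraph

section Switching

open Finset

/-- Exchange the colours of the pairs `uw` and `vw` for every `w ∈ T`. -/
def switch {V C : Type*} [DecidableEq V] (c : V → V → C) (u v : V) (T : Finset V) (a b : V) : C :=
  if b ∈ T then c (Equiv.swap u v a) b
  else if a ∈ T then c a (Equiv.swap u v b) else c a b

lemma switch_symm {V C : Type*} [DecidableEq V] {c : V → V → C} (hc : ∀ a b, c a b = c b a)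
    {u v : V} {T : Finset V}
    (hu : u ∉ T) (hv : v ∉ T) (a b : V) : switch c u v T a b = switch c u v T b a := by
  have key : ∀ x ∈ T, Equiv.swap u v x = x := fun x hx =>
    Equiv.swap_apply_of_ne_of_ne (fun h => hu (h ▸ hx)) (fun h => hv (h ▸ hx))
  unfold switch
  by_cases ha : a ∈ T <;> by_cases hb : b ∈ T
  · rw [if_pos hb, if_pos ha, key a ha, key b hb, hc]
  · rw [if_neg hb, if_pos ha, if_pos ha, hc]
  · rw [if_pos hb, if_neg ha, if_pos hb, hc]
  · rw [if_neg hb, if_neg ha, if_neg ha, if_neg hb, hc]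

lemma switch_self {V C : Type*} [DecidableEq V] {c : V → V → C} {u v : V} {T : Finset V}
    (hu : u ∉ T) (hv : v ∉ T) (a : V) : switch c u v T a a = c a a := by
  unfold switch
  by_cases ha : a ∈ T
  · rw [if_pos ha, Equiv.swap_apply_of_ne_of_ne (fun h : a = u => hu (h ▸ ha))
      (fun h : a = v => hv (h ▸ ha))]
  · simp [ha]

lemma card_switch {V C : Type*} [Fintype V] [DecidableEq V] [DecidableEq C]
    {c : V → V → C} {u v : V} {T : Finset V} (hu : u ∉ T) (hv : v ∉ T)
    (hT : ∀ γ, #{w ∈ T | c u w = γ} = #{w ∈ T | c v w = γ}) (γ : C) (a : V) :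
    #{b | switch c u v T a b = γ} = #{b | c a b = γ} := by
  have split : ∀ p : V → Prop, ∀ [DecidablePred p],
      #{b | p b} = #{b ∈ T | p b} + #{b ∈ Tᶜ | p b} := by
    intro p _
    rw [← card_union_of_disjoint (disjoint_filter_filter disjoint_compl_right),
      ← filter_union, union_compl]
  by_cases hau : a = u
  · subst hau
    rw [split, split (fun b => c a b = γ), hT]
    congr 2
    · exact filter_congr fun b hb => by simp [switch, hb]
    · exact filter_congr fun b hb => by
        rw [mem_compl] at hb; simp [switch, hb, hu]
  by_cases hav : a = v
  · subst hav
    rw [split, split (fun b => c a b = γ), ← hT]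
    congr 2
    · exact filter_congr fun b hb => by simp [switch, hb]
    · exact filter_congr fun b hb => by
        rw [mem_compl] at hb; simp [switch, hb, hv]
  have hs : Equiv.swap u v a = a := Equiv.swap_apply_of_ne_of_ne hau hav
  by_cases haT : a ∈ T
  · refine card_bij (fun b _ => Equiv.swap u v b) ?_ (fun _ _ _ _ h => Equiv.injective _ h) ?_
    · intro b hb
      simp only [mem_filter, mem_univ, true_and] at hb ⊢
      rw [← hb]
      by_cases hbT : b ∈ T
      · have : Equiv.swap u v b = b :=
          Equiv.swap_apply_of_ne_of_ne (fun h => hu (h ▸ hbT)) (fun h => hv (h ▸ hbT))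
        simp [switch, hbT, this, hs]
      · simp [switch, hbT, haT]
    · intro b hb
      simp only [mem_filter, mem_univ, true_and] at hb
      refine ⟨Equiv.swap u v b, ?_, by simp⟩
      simp only [mem_filter, mem_univ, true_and]
      by_cases hbT : b ∈ T
      · have : Equiv.swap u v b = b :=
          Equiv.swap_apply_of_ne_of_ne (fun h => hu (h ▸ hbT)) (fun h => hv (h ▸ hbT))
        simp [switch, hbT, this, hs, hb]
      · have : Equiv.swap u v b ∉ T := by
          rcases eq_or_ne b u with rfl | h1
          · simpa using hv
          rcases eq_or_ne b v with rfl | h2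
          · simpa using hu
          rwa [Equiv.swap_apply_of_ne_of_ne h1 h2]
        simp [switch, this, haT, hb]
  · congr 1
    exact filter_congr fun b _ => by simp [switch, hs, haT]

/-- In the directed graph on colours with an arc `c u w → c v w` for each `w`, every colour that
cannot be separated from `β` by a closed set is reached by a trail that never leaves it. -/
lemma exists_trail {V C : Type*} [Fintype V] [DecidableEq V] [DecidableEq C]
    (c : V → V → C) {u v : V} {α β : C}
    (hcut : ∀ S : Finset C, (∀ w, w ≠ u → w ≠ v → c u w ∈ S → c v w ∈ S) → β ∈ S → α ∈ S) :
    ∃ T : Finset V, u ∉ T ∧ v ∉ T ∧ (∀ w ∈ T, c u w ≠ α) ∧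
      ∀ γ, #{w ∈ T | c u w = γ} + (if γ = α then 1 else 0) =
        #{w ∈ T | c v w = γ} + (if γ = β then 1 else 0) := by
  let good : Finset C → Prop := fun S => β ∈ S ∧ ∀ γ ∈ S, ∃ T : Finset V, u ∉ T ∧ v ∉ T ∧
    (∀ w ∈ T, c u w ∈ S ∧ c u w ≠ γ) ∧
      ∀ κ, #{w ∈ T | c u w = κ} + (if κ = γ then 1 else 0) =
        #{w ∈ T | c v w = κ} + (if κ = β then 1 else 0)
  classical
  obtain ⟨S, hS, hmax⟩ := exists_max_image
    ((insert β (univ.image (c v))).powerset.filter good) card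
    ⟨{β}, by
      refine mem_filter.2 ⟨by simp, mem_singleton_self _, fun γ hγ => ⟨∅, ?_⟩⟩
      rw [mem_singleton] at hγ
      simp [hγ]⟩
  obtain ⟨hSsub, hβ, hg⟩ := mem_filter.1 hS
  have hα : α ∈ S := by
    refine hcut S (fun w hwu hwv hw => ?_) hβ
    by_contra hw'
    obtain ⟨T, hu, hv, ht, hb⟩ := hg _ hw
    have hwT : w ∉ T := fun h => (ht w h).2 rfl
    have hnew : insert (c v w) S ∈ (insert β (univ.image (c v))).powerset.filter good := by
      refine mem_filter.2 ⟨?_, mem_insert_of_mem hβ, fun γ hγ => ?_⟩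
      · rw [mem_powerset] at hSsub ⊢
        exact insert_subset (mem_insert_of_mem (mem_image_of_mem _ (mem_univ _))) hSsub
      · rcases mem_insert.1 hγ with rfl | hγ
        · refine ⟨insert w T, by simp [hu, hwu.symm], by simp [hv, hwv.symm], ?_, fun κ => ?_⟩
          · intro x hx
            have : c u x ∈ S := by
              rcases mem_insert.1 hx with rfl | hx
              · exact hw
              · exact (ht x hx).1
            exact ⟨mem_insert_of_mem this, fun h => hw' (h ▸ this)⟩
          · have := hb κ
            rw [filter_insert, filter_insert]
            by_cases h1 : c u w = κ <;> by_cases h2 : c v w = κ <;>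
              simp [h1, h2, hwT, eq_comm] at this ⊢ <;> grind
        · obtain ⟨T', hu', hv', ht', hb'⟩ := hg _ hγ
          exact ⟨T', hu', hv', fun x hx => ⟨mem_insert_of_mem (ht' x hx).1, (ht' x hx).2⟩, hb'⟩
    have := hmax _ hnew
    rw [card_insert_of_notMem hw'] at this
    omega
  obtain ⟨T, hu, hv, ht, hb⟩ := hg _ hα
  exact ⟨T, hu, hv, fun w hw => (ht w hw).2, hb⟩

/-- If no closed set of colours separates `c v x` from `c u x`, then the pair `vx` can be given
the colour of `ux` without changing any colour degree; among the pairs of that colour, only pairs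
meeting `x` or `v` may be lost. -/
lemma exists_switch {V C : Type*} [Fintype V] [DecidableEq V] [DecidableEq C]
    {c : V → V → C} (hc : ∀ a b, c a b = c b a) {u v x : V}
    (hdiag : c u u = c v v) (hxu : x ≠ u) (hxv : x ≠ v)
    (hcut : ∀ S : Finset C, (∀ w, w ≠ u → w ≠ v → c u w ∈ S → c v w ∈ S) → c v x ∈ S →
      c u x ∉ S → #{w | c v w ∈ S} ≤ #{w | c u w ∈ S}) :
    ∃ c' : V → V → C, (∀ a b, c' a b = c' b a) ∧ (∀ a, c' a a = c a a) ∧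
      (∀ γ a, #{b | c' a b = γ} = #{b | c a b = γ}) ∧ c' v x = c u x ∧
      ∀ a b, c a b = c u x → a ≠ x → a ≠ v → b ≠ x → b ≠ v → c' a b = c u x := by
  obtain ⟨T, hu, hv, ht, hb⟩ := exists_trail c (u := u) (v := v) (α := c u x) (β := c v x) (by
    intro S hS hβ
    by_contra hα
    refine absurd (hcut S hS hβ hα) (not_le.2 ?_)
    rcases eq_or_ne u v with rfl | huv
    · exact absurd hβ hα
    rw [← card_map (Equiv.swap u v).toEmbedding]
    refine card_lt_card ⟨fun w hw => ?_, fun h => ?_⟩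
    · obtain ⟨y, hy, rfl⟩ := mem_map.1 hw
      simp only [mem_filter, mem_univ, true_and, Equiv.coe_toEmbedding] at hy ⊢
      rcases eq_or_ne y u with rfl | hyu
      · rwa [Equiv.swap_apply_left, ← hdiag]
      rcases eq_or_ne y v with rfl | hyv
      · rwa [Equiv.swap_apply_right, hc]
      rw [Equiv.swap_apply_of_ne_of_ne hyu hyv]
      exact hS y hyu hyv hy
    · obtain ⟨y, hy, hyx⟩ := mem_map.1 (h (mem_filter.2 ⟨mem_univ x, hβ⟩))
      rw [Equiv.coe_toEmbedding, Equiv.swap_apply_eq_iff,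
        Equiv.swap_apply_of_ne_of_ne hxu hxv] at hyx
      subst hyx
      exact hα (mem_filter.1 hy).2)
  have hxT : x ∉ T := fun h => ht x h rfl
  have hu' : u ∉ insert x T := by simp [hu, hxu.symm]
  have hv' : v ∉ insert x T := by simp [hv, hxv.symm]
  refine ⟨switch c u v (insert x T), switch_symm hc hu' hv', switch_self hu' hv',
    card_switch hu' hv' fun γ => ?_, by simp [switch], ?_⟩
  · have := hb γ
    rw [filter_insert, filter_insert]
    by_cases h1 : c u x = γ <;> by_cases h2 : c v x = γ <;>
      simp [h1, h2, hxT] at this ⊢ <;> grind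
  · have main : ∀ a b, c a b = c u x → a ≠ v → b ≠ x → b ∈ insert x T →
        c (Equiv.swap u v a) b = c u x := by
      intro a b hab hav hbx hbT
      rcases eq_or_ne a u with rfl | hau
      · exact absurd hab (ht b ((mem_insert.1 hbT).resolve_left hbx))
      · rw [Equiv.swap_apply_of_ne_of_ne hau hav, hab]
    intro a b hab hax hav hbx hbv
    unfold switch
    split_ifs with h1 h2
    · exact main a b hab hav hbx h1
    · rw [hc] at hab ⊢
      exact main b a hab hbv hax h2
    · exact hab

end Switching

section Matching

open Finset

/-- `Γ` has a perfect matching of the finset `U`, given by an involution. -/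
def PairsUp {V : Type*} (Γ : V → V → Prop) (U : Finset V) : Prop :=
  ∃ τ : V → V, ∀ a ∈ U, τ a ∈ U ∧ τ (τ a) = a ∧ Γ a (τ a)

/-- The relation `Γ` is not two-colourable on the finset `K`. -/
def NonBip {V : Type*} (Γ : V → V → Prop) (K : Finset V) : Prop :=
  ∀ χ : V → Bool, ∃ x ∈ K, ∃ y ∈ K, Γ x y ∧ χ x = χ y

lemma PairsUp.mono {V : Type*} {Γ Γ' : V → V → Prop} {U : Finset V} (h : PairsUp Γ U)
    (hΓ : ∀ a ∈ U, ∀ b ∈ U, Γ a b → Γ' a b) : PairsUp Γ' U := by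
  obtain ⟨τ, hτ⟩ := h
  exact ⟨τ, fun a ha => ⟨(hτ a ha).1, (hτ a ha).2.1, hΓ a ha _ (hτ a ha).1 (hτ a ha).2.2⟩⟩

lemma PairsUp.union {V : Type*} [DecidableEq V] {Γ : V → V → Prop} {U W : Finset V}
    (hU : PairsUp Γ U) (hW : PairsUp Γ W) (hd : Disjoint U W) : PairsUp Γ (U ∪ W) := by
  obtain ⟨τ, hτ⟩ := hU
  obtain ⟨ρ, hρ⟩ := hW
  refine ⟨fun a => if a ∈ U then τ a else ρ a, fun a ha => ?_⟩
  by_cases haU : a ∈ U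
  · obtain ⟨h1, h2, h3⟩ := hτ a haU
    simp [haU, h1, h2, h3]
  · obtain ⟨h1, h2, h3⟩ := hρ a ((mem_union.1 ha).resolve_left haU)
    simp [haU, h1, h2, h3, disjoint_right.1 hd h1]

lemma pairsUp_pair {V : Type*} [DecidableEq V] {Γ : V → V → Prop}
    (hΓ : ∀ a b, Γ a b → Γ b a) {a b : V} (hab : Γ a b) : PairsUp Γ {a, b} := by
  refine ⟨Equiv.swap a b, fun x hx => ?_⟩
  rcases mem_insert.1 hx with rfl | hx
  · simp [hab]
  · rw [mem_singleton] at hx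
    subst hx
    simp [hΓ _ _ hab]

lemma pairsUp_image {V : Type*} [DecidableEq V] {Γ : V → V → Prop}
    (hΓ : ∀ a b, Γ a b → Γ b a) (p : ℕ → V) (l : ℕ)
    (hp : ∀ i < 2 * l, ∀ j < 2 * l, p i = p j → i = j)
    (hE : ∀ i < l, Γ (p (2 * i)) (p (2 * i + 1))) :
    PairsUp Γ ((range (2 * l)).image p) := by
  induction l with
  | zero => exact ⟨id, by simp⟩
  | succ l ih =>
    have e : (range (2 * (l + 1))).image p =
        (range (2 * l)).image p ∪ {p (2 * l), p (2 * l + 1)} := by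
      ext x
      simp only [mem_image, mem_range, mem_union, mem_insert, mem_singleton]
      constructor
      · rintro ⟨i, hi, rfl⟩
        by_cases h1 : i < 2 * l
        · exact Or.inl ⟨i, h1, rfl⟩
        · obtain rfl | rfl : i = 2 * l ∨ i = 2 * l + 1 := by omega
          · simp
          · simp
      · rintro (⟨i, hi, rfl⟩ | rfl | rfl)
        · exact ⟨i, by omega, rfl⟩
        · exact ⟨_, by omega, rfl⟩
        · exact ⟨_, by omega, rfl⟩
    rw [e]
    refine (ih (fun i hi j hj => hp i (by omega) j (by omega)) fun i hi => hE i (by omega)).union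
      (pairsUp_pair hΓ (hE l (by omega))) (disjoint_left.2 fun x hx hx' => ?_)
    obtain ⟨i, hi, rfl⟩ := mem_image.1 hx
    rw [mem_range] at hi
    simp only [mem_insert, mem_singleton] at hx'
    rcases hx' with h | h
    · have := hp i (by omega) _ (by omega) h
      omega
    · have := hp i (by omega) _ (by omega) h
      omega

/-- The cycle of `σ` through `v`, as a finset. -/
noncomputable def cycle {V : Type*} [Fintype V] [DecidableEq V] (σ : Equiv.Perm V) (v : V) :
    Finset V :=
  (range (Function.minimalPeriod σ v)).image fun i => σ^[i] v

lemma minimalPeriod_perm_pos {V : Type*} [Fintype V] [DecidableEq V] (σ : Equiv.Perm V) (v : V) :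
    0 < Function.minimalPeriod σ v :=
  Function.minimalPeriod_pos_of_mem_periodicPts
    (σ.injective.mem_periodicPts v)

lemma mem_cycle {V : Type*} [Fintype V] [DecidableEq V] {σ : Equiv.Perm V} {v w : V} :
    w ∈ cycle σ v ↔ σ.SameCycle v w := by
  simp only [cycle, mem_image, mem_range]
  constructor
  · rintro ⟨i, -, rfl⟩
    exact ⟨i, by simp [Equiv.Perm.iterate_eq_pow]⟩
  · intro h
    obtain ⟨i, -, -, hi⟩ := h.exists_pow_eq''
    refine ⟨i % Function.minimalPeriod σ v, Nat.mod_lt _ (minimalPeriod_perm_pos σ v), ?_⟩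
    rw [Function.iterate_mod_minimalPeriod_eq, Equiv.Perm.iterate_eq_pow, hi]

lemma self_mem_cycle {V : Type*} [Fintype V] [DecidableEq V] (σ : Equiv.Perm V) (v : V) :
    v ∈ cycle σ v := mem_cycle.2 (Equiv.Perm.SameCycle.refl _ _)

lemma apply_mem_cycle {V : Type*} [Fintype V] [DecidableEq V] {σ : Equiv.Perm V} {v w : V} :
    σ w ∈ cycle σ v ↔ w ∈ cycle σ v := by
  simp [mem_cycle]

lemma cycle_eq {V : Type*} [Fintype V] [DecidableEq V] {σ : Equiv.Perm V} {v w : V}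
    (h : w ∈ cycle σ v) : cycle σ w = cycle σ v := by
  ext x
  rw [mem_cycle, mem_cycle]
  exact ⟨(mem_cycle.1 h).trans, (mem_cycle.1 h).symm.trans⟩

lemma iterate_mem_cycle {V : Type*} [Fintype V] [DecidableEq V] (σ : Equiv.Perm V) (v : V)
    (i : ℕ) : σ^[i] v ∈ cycle σ v :=
  mem_cycle.2 ⟨i, by simp [Equiv.Perm.iterate_eq_pow]⟩

lemma card_cycle {V : Type*} [Fintype V] [DecidableEq V] (σ : Equiv.Perm V) (v : V) :
    #(cycle σ v) = Function.minimalPeriod σ v := by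
  rw [cycle, card_image_of_injOn, card_range]
  intro i hi j hj h
  exact Function.iterate_injOn_Iio_minimalPeriod (by simpa using hi) (by simpa using hj) h

lemma pairsUp_cycle {V : Type*} [Fintype V] [DecidableEq V] {Γ : V → V → Prop}
    (hΓ : ∀ a b, Γ a b → Γ b a) {σ : Equiv.Perm V} {v : V} (hE : ∀ a ∈ cycle σ v, Γ a (σ a))
    (hev : Even #(cycle σ v)) : PairsUp Γ (cycle σ v) := by
  obtain ⟨l, hl⟩ := hev
  rw [card_cycle, ← two_mul] at hl
  rw [cycle, hl]
  refine pairsUp_image hΓ _ l (fun i hi j hj h => ?_) fun i _ => ?_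
  · exact Function.iterate_injOn_Iio_minimalPeriod (by simpa [hl] using hi)
      (by simpa [hl] using hj) h
  · simp only [Function.iterate_succ_apply']
    exact hE _ (iterate_mem_cycle σ v _)

lemma pairsUp_cycle_erase {V : Type*} [Fintype V] [DecidableEq V] {Γ : V → V → Prop}
    (hΓ : ∀ a b, Γ a b → Γ b a) {σ : Equiv.Perm V} {v : V}
    (hE : ∀ a ∈ cycle σ v, a ≠ v → σ a ≠ v → Γ a (σ a))
    (hodd : Odd #(cycle σ v)) : PairsUp Γ ((cycle σ v).erase v) := by
  obtain ⟨l, hl⟩ := hodd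
  rw [card_cycle] at hl
  have hinj : ∀ i ≤ 2 * l, ∀ j ≤ 2 * l, σ^[i] v = σ^[j] v → i = j := fun i hi j hj h =>
    Function.iterate_injOn_Iio_minimalPeriod (f := σ) (x := v)
      (by simp only [Set.mem_Iio]; omega) (by simp only [Set.mem_Iio]; omega) h
  have hne : ∀ i, 0 < i → i ≤ 2 * l → σ^[i] v ≠ v := fun i h0 hi h => by
    have := hinj i hi 0 (by omega) h
    omega
  have e : (cycle σ v).erase v = (range (2 * l)).image fun i => σ^[i + 1] v := by
    ext x
    simp only [cycle, hl, mem_erase, mem_image, mem_range]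
    constructor
    · rintro ⟨hx, i, hi, rfl⟩
      obtain _ | i := i
      · exact absurd rfl hx
      · exact ⟨i, by omega, rfl⟩
    · rintro ⟨i, hi, rfl⟩
      exact ⟨hne _ (by omega) (by omega), i + 1, by omega, rfl⟩
  rw [e]
  refine pairsUp_image hΓ _ l (fun i hi j hj h => ?_) fun i hi => ?_
  · have := hinj _ (by omega) _ (by omega) h
    omega
  · have h1 := hE _ (iterate_mem_cycle σ v (2 * i + 1)) (hne _ (by omega) (by omega))
    rw [← Function.iterate_succ_apply' σ] at h1
    exact h1 (hne _ (by omega) (by omega))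

lemma nonBip_cycle {V : Type*} [Fintype V] [DecidableEq V] {Γ : V → V → Prop}
    {σ : Equiv.Perm V} {v : V} (hE : ∀ a ∈ cycle σ v, Γ a (σ a))
    (hodd : Odd #(cycle σ v)) : NonBip Γ (cycle σ v) := by
  intro χ
  by_contra! hcon
  have key : ∀ i, χ (σ^[i] v) = if Even i then χ v else !χ v := by
    intro i
    induction i with
    | zero => simp
    | succ i ih =>
      have hm := iterate_mem_cycle σ v i
      have := hcon _ hm _ (apply_mem_cycle.2 hm) (hE _ hm)
      rw [Function.iterate_succ_apply']
      rw [ih] at this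
      revert this
      by_cases hi : Even i <;> simp only [Nat.even_add_one, hi, if_true, if_false, not_true,
        not_false_eq_true] <;> cases χ v <;> cases χ (σ (σ^[i] v)) <;> simp
  have := key (Function.minimalPeriod σ v)
  rw [Function.iterate_minimalPeriod, ← card_cycle, if_neg (Nat.not_even_iff_odd.2 hodd)] at this
  simp at this

/-- Suppose that in a family `S` of symmetric relations, any two disjoint nonbipartite vertex sets
can be joined by an edge `wv` at the cost of edges meeting `w` or `v` only. If a member of `S`
contains a spanning subgraph of edges and oriented cycles, then some member of `S` has a perfect
matching. -/
lemma exists_perfect_matching {V : Type*} [Fintype V] [DecidableEq V]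
    (hV : Even (Fintype.card V)) {S : Set (V → V → Prop)}
    (hsymm : ∀ Γ ∈ S, ∀ a b, Γ a b → Γ b a)
    (hmerge : ∀ Γ ∈ S, ∀ K L : Finset V, Disjoint K L → NonBip Γ K → NonBip Γ L →
      ∃ Γ' ∈ S, ∃ w ∈ K, ∃ v ∈ L, Γ' w v ∧
        ∀ a b, Γ a b → a ≠ w → a ≠ v → b ≠ w → b ≠ v → Γ' a b)
    {Γ : V → V → Prop} (hΓS : Γ ∈ S) {σ : Equiv.Perm V} (hσ : ∀ v, Γ v (σ v)) :
    ∃ Γ' ∈ S, ∃ τ : V → V, ∀ v, τ (τ v) = v ∧ Γ' v (τ v) := by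
  suffices h : ∀ k, ∀ Γ ∈ S, ∀ U : Finset V, #Uᶜ = k → Even #U → PairsUp Γ U →
      (∀ a ∉ U, σ a ∉ U ∧ Γ a (σ a)) → ∃ Γ' ∈ S, PairsUp Γ' univ by
    obtain ⟨Γ', hS, τ, hτ⟩ := h _ Γ hΓS ∅ rfl (by simp) ⟨id, by simp⟩ (by simp [hσ])
    exact ⟨Γ', hS, τ, fun v => (hτ v (mem_univ v)).2⟩
  intro k
  induction k using Nat.strong_induction_on with
  | _ k ih =>
  intro Γ hS U hk hev hU hσU
  have hsy := hsymm Γ hS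
  have hcyc : ∀ v ∉ U, ∀ a ∈ cycle σ v, a ∉ U := by
    intro v hv a ha
    obtain ⟨i, -, rfl⟩ := mem_image.1 ha
    induction i with
    | zero => exact hv
    | succ i ih =>
      rw [Function.iterate_succ_apply']
      exact (hσU _ (ih (iterate_mem_cycle σ v i))).1
  have hstep : ∀ U' : Finset V, U ⊂ U' → #U'ᶜ < k := fun U' h => by
    rw [← hk]
    exact card_lt_card (compl_ssubset_compl.2 h)
  have hdis : ∀ v ∉ U, Disjoint U (cycle σ v) := fun v hv =>
    disjoint_right.2 fun a ha => hcyc v hv a ha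
  have hext : ∀ v ∉ U, U ⊂ U ∪ cycle σ v := fun v hv =>
    ⟨subset_union_left, fun h => hv (h (mem_union_right _ (self_mem_cycle σ v)))⟩
  have heven : ∀ v ∉ U, Even #(cycle σ v) → ∃ Γ' ∈ S, PairsUp Γ' univ := by
    intro v hv he
    refine ih _ (hstep _ (hext v hv)) Γ hS _ rfl ?_
      (hU.union (pairsUp_cycle hsy (fun a ha => (hσU a (hcyc v hv a ha)).2) he) (hdis v hv)) ?_
    · rw [card_union_of_disjoint (hdis v hv)]
      exact hev.add he
    · intro a ha
      simp only [mem_union, not_or, apply_mem_cycle] at ha ⊢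
      exact ⟨⟨(hσU a ha.1).1, ha.2⟩, (hσU a ha.1).2⟩
  by_cases hfull : U = univ
  · exact ⟨Γ, hS, hfull ▸ hU⟩
  obtain ⟨v₁, hv₁⟩ : ∃ v, v ∉ U := by
    by_contra! h
    exact hfull (eq_univ_iff_forall.2 h)
  rcases Nat.even_or_odd #(cycle σ v₁) with h₁ | h₁
  · exact heven v₁ hv₁ h₁
  obtain ⟨v₂, hv₂⟩ : ∃ v, v ∉ U ∪ cycle σ v₁ := by
    by_contra! h
    have h2 := card_union_of_disjoint (hdis v₁ hv₁)
    rw [eq_univ_iff_forall.2 h, card_univ] at h2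
    rw [h2] at hV
    exact Nat.not_even_iff_odd.2 (hev.add_odd h₁) hV
  rw [mem_union, not_or] at hv₂
  rcases Nat.even_or_odd #(cycle σ v₂) with h₂ | h₂
  · exact heven v₂ hv₂.1 h₂
  have hd12 : Disjoint (cycle σ v₁) (cycle σ v₂) := disjoint_left.2 fun a ha ha' => by
    apply hv₂.2
    rw [← cycle_eq ha, cycle_eq ha']
    exact self_mem_cycle σ v₂
  obtain ⟨Γ', hS', w, hw, v, hv, hwv, hkeep⟩ := hmerge Γ hS _ _ hd12
    (nonBip_cycle (fun a ha => (hσU a (hcyc v₁ hv₁ a ha)).2) h₁)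
    (nonBip_cycle (fun a ha => (hσU a (hcyc v₂ hv₂.1 a ha)).2) h₂)
  have hsy' := hsymm Γ' hS'
  have hwU := hcyc _ hv₁ _ hw
  have hvU := hcyc _ hv₂.1 _ hv
  rw [← cycle_eq hw] at hd12 h₁
  rw [← cycle_eq hv] at hd12 h₂
  have hp₁ : PairsUp Γ' ((cycle σ w).erase w) := by
    refine pairsUp_cycle_erase hsy' (fun a ha haw hσa => ?_) h₁
    have hv' := disjoint_right.1 hd12 (self_mem_cycle σ v)
    exact hkeep a _ (hσU a (hcyc w hwU a ha)).2 haw (fun h => hv' (h ▸ ha)) hσa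
      fun h => hv' (h ▸ apply_mem_cycle.2 ha)
  have hp₂ : PairsUp Γ' ((cycle σ v).erase v) := by
    refine pairsUp_cycle_erase hsy' (fun a ha hav hσa => ?_) h₂
    have hw' := disjoint_left.1 hd12 (self_mem_cycle σ w)
    exact hkeep a _ (hσU a (hcyc v hvU a ha)).2 (fun h => hw' (h ▸ ha)) hav
      (fun h => hw' (h ▸ apply_mem_cycle.2 ha)) hσa
  have hU' : PairsUp Γ' U := hU.mono fun a ha b hb hab =>
    hkeep a b hab (fun h => hwU (h ▸ ha)) (fun h => hvU (h ▸ ha)) (fun h => hwU (h ▸ hb))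
      fun h => hvU (h ▸ hb)
  have hset : ((cycle σ w).erase w ∪ (cycle σ v).erase v) ∪ {w, v} = cycle σ w ∪ cycle σ v := by
    ext x
    have h1 := self_mem_cycle σ w
    have h2 := self_mem_cycle σ v
    simp only [mem_union, mem_erase, mem_insert, mem_singleton]
    grind
  have hp : PairsUp Γ' (cycle σ w ∪ cycle σ v) := by
    rw [← hset]
    refine (hp₁.union hp₂ ?_).union (pairsUp_pair hsy' hwv) ?_
    · exact hd12.mono (erase_subset _ _) (erase_subset _ _)
    · have hv' := disjoint_right.1 hd12 (self_mem_cycle σ v)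
      have hw' := disjoint_left.1 hd12 (self_mem_cycle σ w)
      rw [Finset.disjoint_left]
      intro x hx hx'
      simp only [mem_union, mem_erase, mem_insert, mem_singleton] at hx hx'
      grind
  have hdU : Disjoint U (cycle σ w ∪ cycle σ v) :=
    disjoint_union_right.2 ⟨hdis w hwU, hdis v hvU⟩
  refine ih _ (hstep _ ⟨subset_union_left, fun h => hwU (h ?_)⟩) Γ' hS' _ rfl ?_
    (hU'.union hp hdU) ?_
  · exact mem_union_right _ (mem_union_left _ (self_mem_cycle σ w))
  · rw [card_union_of_disjoint hdU, card_union_of_disjoint hd12]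
    exact hev.add (h₁.add_odd h₂)
  · intro a ha
    simp only [mem_union, not_or, apply_mem_cycle] at ha ⊢
    have h1 := self_mem_cycle σ w
    have h2 := self_mem_cycle σ v
    have h3 := apply_mem_cycle (σ := σ) (v := w) (w := a)
    have h4 := apply_mem_cycle (σ := σ) (v := v) (w := a)
    refine ⟨⟨(hσU a ha.1).1, ha.2⟩, hkeep a _ (hσU a ha.1).2 ?_ ?_ ?_ ?_⟩
    · rintro rfl; exact ha.2.1 h1
    · rintro rfl; exact ha.2.2 h2
    · intro h; exact ha.2.1 (h3.1 (h.symm ▸ h1))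
    · intro h; exact ha.2.2 (h4.1 (h.symm ▸ h2))

end Matching

section Decomposition

open Finset

/-- In a nonbipartite set some edge lies above, and some edge lies below, a common threshold. -/
lemma NonBip.exists_threshold {V : Type*} {Γ : V → V → Prop} {K : Finset V} (hK : NonBip Γ K)
    (d : V → ℕ) : ∃ t, (∃ x ∈ K, ∃ y ∈ K, Γ x y ∧ t ≤ d x ∧ t ≤ d y) ∧
      ∃ x ∈ K, ∃ y ∈ K, Γ x y ∧ d x ≤ t ∧ d y ≤ t := by
  obtain ⟨t, ht, ht'⟩ : ∃ t, (∃ x ∈ K, ∃ y ∈ K, Γ x y ∧ t ≤ d x ∧ t ≤ d y) ∧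
      ¬ ∃ x ∈ K, ∃ y ∈ K, Γ x y ∧ t + 1 ≤ d x ∧ t + 1 ≤ d y := by
    by_contra! h
    have all : ∀ t, ∃ x ∈ K, ∃ y ∈ K, Γ x y ∧ t ≤ d x ∧ t ≤ d y := by
      intro t
      induction t with
      | zero =>
        obtain ⟨x, hx, y, hy, hxy, -⟩ := hK fun _ => true
        exact ⟨x, hx, y, hy, hxy, by simp, by simp⟩
      | succ t ih => exact h t ih
    obtain ⟨x, hx, -, -, -, hxt, -⟩ := all (K.sup d + 1)
    have := le_sup (f := d) hx
    omega
  refine ⟨t, ht, ?_⟩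
  obtain ⟨x, hx, y, hy, hxy, h⟩ := hK fun v => decide (t + 1 ≤ d v)
  rw [decide_eq_decide] at h
  refine ⟨x, hx, y, hy, hxy, ?_⟩
  by_contra hcon
  exact ht' ⟨x, hx, y, hy, hxy, by omega⟩

/-- A realization of `d` as a symmetric colouring of pairs: `0` marks the non-edges, colour `2` is
`r`-regular, each of the `m` colours `3, …, m + 2` is a perfect matching, and colour `1` consists
of the remaining edges. -/
structure IsDecomposition {V : Type*} [Fintype V] (d : V → ℕ) (m r : ℕ)
    (c : V → V → ℕ) : Prop where
  symm : ∀ a b, c a b = c b a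
  diag : ∀ a, c a a = 0
  lt : ∀ a b, c a b < m + 3
  card_zero : ∀ v, #{w | c v w = 0} + d v = Fintype.card V
  card_one : ∀ v, #{w | c v w = 1} + (r + m) = d v
  card_two : ∀ v, #{w | c v w = 2} = r
  card_eq_one : ∀ i, 3 ≤ i → i < m + 3 → ∀ v, #{w | c v w = i} = 1

namespace IsDecomposition

variable {V : Type*} [Fintype V] {d : V → ℕ} {m r : ℕ} {c : V → V → ℕ}

lemma congr (h : IsDecomposition d m r c) {c' : V → V → ℕ} (hsymm : ∀ a b, c' a b = c' b a)
    (hdiag : ∀ a, c' a a = c a a) (hcard : ∀ γ a, #{b | c' a b = γ} = #{b | c a b = γ}) :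
    IsDecomposition d m r c' where
  symm := hsymm
  diag a := (hdiag a).trans (h.diag a)
  lt a b := by
    have h1 : #{w | c a w = c' a b} ≠ 0 := by
      rw [← hcard]
      exact card_ne_zero_of_mem (a := b) (by simp)
    obtain ⟨w, hw⟩ := card_ne_zero.1 h1
    rw [← (mem_filter.1 hw).2]
    exact h.lt a w
  card_zero v := by rw [hcard]; exact h.card_zero v
  card_one v := by rw [hcard]; exact h.card_one v
  card_two v := by rw [hcard]; exact h.card_two v
  card_eq_one i hi hi' v := by rw [hcard]; exact h.card_eq_one i hi hi' v

lemma ne_of_pos (h : IsDecomposition d m r c) {a b : V} (hab : c a b ≠ 0) : a ≠ b := by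
  rintro rfl
  exact hab (h.diag a)

lemma eq_of_eq (h : IsDecomposition d m r c) {v a b : V} (hi : 3 ≤ c v a)
    (hab : c v a = c v b) : a = b :=
  card_le_one.1 (h.card_eq_one _ hi (h.lt _ _) v).le a (by simp) b (by simp [hab])

lemma card_mem_le (h : IsDecomposition d m r c) {S : Finset ℕ} {u v : V}
    (h₁ : 1 ∈ S → 0 ∉ S → d v ≤ d u) (h₀ : 0 ∈ S → 1 ∉ S → d u ≤ d v) :
    #{w | c v w ∈ S} ≤ #{w | c u w ∈ S} := by
  have key : ∀ a, #{w | c a w ∈ S} = ((if 0 ∈ S then #{w | c a w = 0} else 0) +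
      (if 1 ∈ S then #{w | c a w = 1} else 0)) + ∑ γ ∈ S with 2 ≤ γ, #{w | c a w = γ} := by
    intro a
    rw [card_eq_sum_card_fiberwise (f := c a) (t := S) fun w hw => by simpa using hw,
      ← sum_filter_add_sum_filter_not S fun γ => 2 ≤ γ, add_comm]
    have e : ∀ γ ∈ S, #{w ∈ ({w | c a w ∈ S} : Finset V) | c a w = γ} = #{w | c a w = γ} := by
      intro γ hγ
      rw [filter_filter]
      exact congrArg card (filter_congr fun w _ => ⟨fun h => h.2, fun h => ⟨h ▸ hγ, h⟩⟩)
    congr 1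
    · have e2 : S.filter (fun γ => ¬ 2 ≤ γ) = ({0, 1} : Finset ℕ).filter (· ∈ S) := by
        ext γ
        simp only [mem_filter, mem_insert, mem_singleton]
        constructor
        · rintro ⟨h1, h2⟩; exact ⟨by omega, h1⟩
        · rintro ⟨h1, h2⟩; exact ⟨h2, by omega⟩
      rw [sum_congr rfl fun γ hγ => e γ (mem_filter.1 hγ).1, e2, sum_filter,
        sum_pair (by decide)]
    · exact sum_congr rfl fun γ hγ => e γ (mem_filter.1 hγ).1
  have hrest : ∑ γ ∈ S with 2 ≤ γ, #{w | c v w = γ} = ∑ γ ∈ S with 2 ≤ γ, #{w | c u w = γ} := by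
    refine sum_congr rfl fun γ hγ => ?_
    obtain ⟨-, hγ⟩ := mem_filter.1 hγ
    rcases eq_or_lt_of_le hγ with rfl | hγ
    · rw [h.card_two, h.card_two]
    by_cases hm : γ < m + 3
    · rw [h.card_eq_one γ hγ hm, h.card_eq_one γ hγ hm]
    · have e : ∀ a, #{w | c a w = γ} = 0 := fun a => by
        rw [card_eq_zero, filter_eq_empty_iff]
        intro w _ hw
        have := h.lt a w
        omega
      rw [e, e]
  rw [key, key, hrest]
  have a1 := h.card_zero u
  have a2 := h.card_zero v
  have a3 := h.card_one u
  have a4 := h.card_one v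
  by_cases h0 : 0 ∈ S <;> by_cases h1 : 1 ∈ S <;> simp only [h0, h1, if_true, if_false]
  · omega
  · have := h₀ h0 h1; omega
  · have := h₁ h1 h0; omega
  · omega

lemma exists_switch [DecidableEq V] (h : IsDecomposition d m r c) {u v x : V} (hxu : x ≠ u)
    (hxv : x ≠ v)
    (hcut : ∀ S : Finset ℕ, (∀ w, w ≠ u → w ≠ v → c u w ∈ S → c v w ∈ S) → c v x ∈ S →
      c u x ∉ S → (1 ∈ S → 0 ∉ S → d v ≤ d u) ∧ (0 ∈ S → 1 ∉ S → d u ≤ d v)) :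
    ∃ c', IsDecomposition d m r c' ∧ c' v x = c u x ∧
      ∀ a b, c a b = c u x → a ≠ x → a ≠ v → b ≠ x → b ≠ v → c' a b = c u x := by
  obtain ⟨c', h1, h2, h3, h4⟩ := _root_.exists_switch h.symm
    ((h.diag u).trans (h.diag v).symm) hxu hxv fun S hS hβ hα =>
      h.card_mem_le (hcut S hS hβ hα).1 (hcut S hS hβ hα).2
  exact ⟨c', h.congr h1 h2 h3, h4⟩

lemma join_of_one [DecidableEq V] (h : IsDecomposition d m r c) {x y y' : V} (hy : c y y' = 1)
    (hxy' : x ≠ y')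
    (hd : d y ≤ d x) : ∃ c', IsDecomposition d m r c' ∧ c' x y' = 1 ∧
      ∀ a b, c a b = 1 → a ≠ x → a ≠ y' → b ≠ x → b ≠ y' → c' a b = 1 := by
  obtain ⟨c', h1, h2, h3⟩ := h.exists_switch (u := y) (v := x) (x := y')
    (h.ne_of_pos (by simp [hy])).symm hxy'.symm
    fun S _ _ hα => ⟨fun h1 => absurd (hy ▸ h1) hα, fun _ _ => hd⟩
  rw [hy] at h2 h3
  exact ⟨c', h1, h2, fun a b hab h1 h2 h3' h4 => h3 a b hab h2 h1 h4 h3'⟩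

lemma join_of_two [DecidableEq V] (h : IsDecomposition d m r c) (hm : m ≤ 3) {x x' y y' : V}
    (hx : c x x' = 2) (hy : c y y' = 2) (hxy : x ≠ y) (hxy' : x ≠ y') (hx'y : x' ≠ y)
    (hx'y' : x' ≠ y') (h1 : d y ≤ d x) (h2 : d y ≤ d x') (h3 : d y' ≤ d x) (h4 : d y' ≤ d x') :
    ∃ c', IsDecomposition d m r c' ∧ ∃ w, (w = x ∨ w = x') ∧ ∃ v, (v = y ∨ v = y') ∧
      c' w v = 2 ∧ ∀ a b, c a b = 2 → a ≠ w → a ≠ v → b ≠ w → b ≠ v → c' a b = 2 := by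
  by_contra hcon
  have hxx := h.ne_of_pos (show c x x' ≠ 0 by simp [hx])
  have hyy := h.ne_of_pos (show c y y' ≠ 0 by simp [hy])
  have hx2 : c x' x = 2 := by rw [h.symm, hx]
  have hy2 : c y' y = 2 := by rw [h.symm, hy]
  have cell : ∀ a a' b b', (a = x ∨ a = x') → (b = y ∨ b = y') → c a' a = 2 → c b' b = 2 →
      a ≠ b → d b ≤ d a' → d b' ≤ d a → 3 ≤ c a b := by
    intro a a' b b' ha hb haa hbb hab hd hd'
    by_contra hlt
    obtain h0 | h0 | h0 : c a b = 0 ∨ c a b = 1 ∨ c a b = 2 := by omega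
    · obtain ⟨c', k1, k2, k3⟩ := h.exists_switch (u := b') (v := a) (x := b)
        (h.ne_of_pos (by simp [hbb])).symm hab.symm
        fun S _ hβ _ => ⟨fun _ h0' => absurd (h0 ▸ hβ) h0', fun _ _ => hd'⟩
      rw [hbb] at k2 k3
      exact hcon ⟨c', k1, a, ha, b, hb, k2, fun p q hpq p1 p2 q1 q2 => k3 p q hpq p2 p1 q2 q1⟩
    · rw [h.symm] at h0
      obtain ⟨c', k1, k2, k3⟩ := h.exists_switch (u := a') (v := b) (x := a)
        (h.ne_of_pos (by simp [haa])).symm hab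
        fun S _ hβ _ => ⟨fun _ _ => hd, fun _ h1' => absurd (h0 ▸ hβ) h1'⟩
      rw [haa] at k2 k3
      exact hcon ⟨c', k1, a, ha, b, hb, by rw [k1.symm, k2], k3⟩
    · exact hcon ⟨c, h, a, ha, b, hb, h0, fun p q hpq _ _ _ _ => hpq⟩
  have diag : ∀ b b', (b = y ∨ b = y') → c b b' = 2 → x ≠ b → x' ≠ b' → c x b ≠ c x' b' := by
    intro b b' hb hbb hxb hxb' heq
    obtain ⟨c', k1, k2, k3⟩ := h.exists_switch (u := x') (v := b) (x := x) hxx hxb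
      fun S hS hβ hα => by
        refine absurd ?_ hα
        rw [hx2, ← hbb]
        refine hS b' hxb'.symm (h.ne_of_pos (by simp [hbb])).symm ?_
        rwa [← heq, h.symm]
    rw [hx2] at k2 k3
    exact hcon ⟨c', k1, x, Or.inl rfl, b, hb, by rw [k1.symm, k2], k3⟩
  have c1 := cell x x' y y' (by simp) (by simp) hx2 hy2 hxy h2 h3
  have c2 := cell x x' y' y (by simp) (by simp) hx2 hy hxy' h4 h1
  have c3 := cell x' x y y' (by simp) (by simp) hx hy2 hx'y h1 h4
  have c4 := cell x' x y' y (by simp) (by simp) hx hy hx'y' h3 h2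
  have d1 := diag y y' (by simp) hy hxy hx'y'
  have d2 := diag y' y (by simp) hy2 hxy' hx'y
  have r1 : c x y ≠ c x y' := fun he => hyy (h.eq_of_eq c1 he)
  have r2 : c x' y ≠ c x' y' := fun he => hyy (h.eq_of_eq c3 he)
  have r3 : c x y ≠ c x' y := fun he =>
    hxx (h.eq_of_eq (v := y) (by rwa [h.symm]) (by rwa [h.symm y, h.symm y]))
  have r4 : c x y' ≠ c x' y' := fun he =>
    hxx (h.eq_of_eq (v := y') (by rwa [h.symm]) (by rwa [h.symm y', h.symm y']))
  have l1 := h.lt x y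
  have l2 := h.lt x y'
  have l3 := h.lt x' y
  have l4 := h.lt x' y'
  omega

lemma exists_matching_one [DecidableEq V] (hV : Even (Fintype.card V)) (h : IsDecomposition d m r c)
    {σ : Equiv.Perm V} (hσ : ∀ v, c v (σ v) = 1) :
    ∃ c', IsDecomposition d m r c' ∧ ∃ τ : V → V, ∀ v, τ (τ v) = v ∧ c' v (τ v) = 1 := by
  suffices hmerge : _ by
    obtain ⟨_, ⟨c', h', rfl⟩, τ, hτ⟩ := exists_perfect_matching hV
      (S := {Γ | ∃ c, IsDecomposition d m r c ∧ Γ = fun a b => c a b = 1})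
      (by rintro _ ⟨c, h, rfl⟩ a b hab; rwa [h.symm]) hmerge ⟨c, h, rfl⟩ hσ
    exact ⟨c', h', τ, hτ⟩
  rintro _ ⟨c, h, rfl⟩ K L hKL hK hL
  obtain ⟨x, hx, x', hx', hxx, -⟩ := hK fun _ => true
  obtain ⟨y, hy, y', hy', hyy, -⟩ := hL fun _ => true
  have hne : ∀ a ∈ K, ∀ b ∈ L, a ≠ b := fun a ha b hb he =>
    Finset.disjoint_left.1 hKL ha (he ▸ hb)
  rcases le_total (d y) (d x) with hd | hd
  · obtain ⟨c', h1, h2, h3⟩ := h.join_of_one hyy (hne x hx y' hy') hd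
    exact ⟨_, ⟨c', h1, rfl⟩, x, hx, y', hy', h2, h3⟩
  · obtain ⟨c', h1, h2, h3⟩ := h.join_of_one hxx (hne x' hx' y hy).symm hd
    exact ⟨_, ⟨c', h1, rfl⟩, x', hx', y, hy, (h1.symm _ _).trans h2,
      fun a b hab p q p' q' => h3 a b hab q p q' p'⟩

lemma exists_matching_two [DecidableEq V] (hV : Even (Fintype.card V)) (hm : m ≤ 3)
    (h : IsDecomposition d m r c)
    {σ : Equiv.Perm V} (hσ : ∀ v, c v (σ v) = 2) :
    ∃ c', IsDecomposition d m r c' ∧ ∃ τ : V → V, ∀ v, τ (τ v) = v ∧ c' v (τ v) = 2 := by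
  suffices hmerge : _ by
    obtain ⟨_, ⟨c', h', rfl⟩, τ, hτ⟩ := exists_perfect_matching hV
      (S := {Γ | ∃ c, IsDecomposition d m r c ∧ Γ = fun a b => c a b = 2})
      (by rintro _ ⟨c, h, rfl⟩ a b hab; rwa [h.symm]) hmerge ⟨c, h, rfl⟩ hσ
    exact ⟨c', h', τ, hτ⟩
  rintro _ ⟨c, h, rfl⟩ K L hKL hK hL
  have hne : ∀ a ∈ K, ∀ b ∈ L, a ≠ b := fun a ha b hb he =>
    Finset.disjoint_left.1 hKL ha (he ▸ hb)
  obtain ⟨s, ⟨x, hx, x', hx', hxx, hsx, hsx'⟩, ⟨z, hz, z', hz', hzz, hsz, hsz'⟩⟩ :=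
    hK.exists_threshold d
  obtain ⟨t, ⟨y, hy, y', hy', hyy, hty, hty'⟩, ⟨q, hq, q', hq', hqq, htq, htq'⟩⟩ :=
    hL.exists_threshold d
  rcases le_total t s with hts | hts
  · obtain ⟨c', h1, w, hw, v, hv, h2, h3⟩ := h.join_of_two hm hxx hqq (hne _ hx _ hq)
      (hne _ hx _ hq') (hne _ hx' _ hq) (hne _ hx' _ hq') (by omega) (by omega) (by omega)
      (by omega)
    exact ⟨_, ⟨c', h1, rfl⟩, w, by rcases hw with rfl | rfl <;> assumption, v,
      by rcases hv with rfl | rfl <;> assumption, h2, h3⟩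
  · obtain ⟨c', h1, w, hw, v, hv, h2, h3⟩ := h.join_of_two hm hyy hzz (hne _ hz _ hy).symm
      (hne _ hz' _ hy).symm (hne _ hz _ hy').symm (hne _ hz' _ hy').symm (by omega) (by omega)
      (by omega) (by omega)
    exact ⟨_, ⟨c', h1, rfl⟩, v, by rcases hv with rfl | rfl <;> assumption, w,
      by rcases hw with rfl | rfl <;> assumption, (h1.symm _ _).trans h2,
      fun a b hab p q p' q' => h3 a b hab q p q' p'⟩

end IsDecomposition

end Decomposition

section Factors

open Finset

/-- A bipartite relation in which left degrees are at least `s` and right degrees at most `s`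
contains the graph of a permutation. -/
lemma exists_perm_of_card_le {V : Type*} [Fintype V] [DecidableEq V] {E : V → V → Prop}
    [DecidableRel E] {s : ℕ} (hs : 0 < s) (hout : ∀ v, s ≤ #{w | E v w})
    (hin : ∀ w, #{v | E v w} ≤ s) : ∃ σ : Equiv.Perm V, ∀ v, E v (σ v) := by
  obtain ⟨f, hf, hE⟩ := (all_card_le_biUnion_card_iff_exists_injective
    fun v => ({w | E v w} : Finset V)).1 fun A => by
      refine Nat.le_of_mul_le_mul_right (card_mul_le_card_mul E (fun a ha => ?_) fun b _ => ?_) hs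
      · refine (hout a).trans (card_le_card fun w hw => ?_)
        rw [mem_bipartiteAbove]
        exact ⟨mem_biUnion.2 ⟨a, ha, hw⟩, (mem_filter.1 hw).2⟩
      · refine le_trans (card_le_card fun v hv => ?_) (hin b)
        simpa using ((mem_bipartiteBelow E).1 hv).2
  exact ⟨Equiv.ofBijective f (Finite.injective_iff_bijective.1 hf),
    fun v => (mem_filter.1 (hE v)).2⟩

/-- A regular graph of positive even degree has an orientation in which out-degrees do not exceed
half of the degree. -/
lemma exists_orientation {V : Type*} [Fintype V] [DecidableEq V] {Γ : V → V → Prop}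
    [DecidableRel Γ] (hsymm : ∀ a b, Γ a b → Γ b a) (hirr : ∀ a, ¬ Γ a a) {s : ℕ}
    (hdeg : ∀ v, #{w | Γ v w} ≤ 2 * s) :
    ∃ D : V → V → Prop, (∀ a b, D a b → Γ a b ∧ ¬ D b a) ∧ (∀ a b, Γ a b → D a b ∨ D b a) ∧
      ∀ [DecidableRel D] v, #{w | D v w} ≤ s := by
  classical
  let t : {e : Sym2 V // e ∈ Sym2.fromRel (r := Γ) ⟨hsymm⟩} → Finset (V × Fin s) := fun e =>
    ({v | v ∈ e.1} : Finset V) ×ˢ univ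
  obtain ⟨f, hf, hft⟩ := (all_card_le_biUnion_card_iff_exists_injective t).1 fun A => by
    have hB : A.biUnion t = (A.biUnion fun e => ({v | v ∈ e.1} : Finset V)) ×ˢ univ := by
      ext x
      simp [t]
    have key : #A * 2 ≤ #(A.biUnion fun e => ({v | v ∈ e.1} : Finset V)) * (2 * s) := by
      refine card_mul_le_card_mul (fun e v => v ∈ e.1) (fun e he => ?_) fun v _ => ?_
      · obtain ⟨e, hΓ⟩ := e
        induction e with
        | _ a b =>
          have hab : a ≠ b := by
            rintro rfl
            exact hirr _ (Sym2.fromRel_prop.1 hΓ)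
          rw [← card_pair hab]
          refine card_le_card fun x hx => ?_
          rw [mem_bipartiteAbove, mem_biUnion]
          have hx' : x ∈ s(a, b) := by simpa using hx
          exact ⟨⟨_, he, by simpa using hx'⟩, hx'⟩
      · rw [← card_map (Function.Embedding.subtype _)]
        refine le_trans (card_le_card (t := ({w | Γ v w} : Finset V).image fun w => s(v, w))
          fun e he => ?_) (card_image_le.trans (hdeg v))
        obtain ⟨⟨e, hΓ⟩, he', rfl⟩ := mem_map.1 he
        obtain ⟨w, rfl⟩ := ((mem_bipartiteBelow _).1 he').2
        exact mem_image.2 ⟨w, by simpa using Sym2.fromRel_prop.1 hΓ, rfl⟩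
    rw [hB, card_product, card_univ, Fintype.card_fin]
    nlinarith
  have hend : ∀ a b (h : Γ a b), (f ⟨s(a, b), h⟩).1 = a ∨ (f ⟨s(a, b), h⟩).1 = b := by
    intro a b h
    have := hft ⟨s(a, b), h⟩
    simpa [t] using this
  have hswap : ∀ a b (h : Γ a b), f ⟨s(a, b), h⟩ = f ⟨s(b, a), hsymm a b h⟩ := by
    intro a b h
    congr 2
    exact Sym2.eq_swap
  refine ⟨fun a b => ∃ h : Γ a b, (f ⟨s(a, b), h⟩).1 = a, ?_, ?_, ?_⟩
  · rintro a b ⟨h, h1⟩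
    refine ⟨h, ?_⟩
    rintro ⟨h', h2⟩
    rw [hswap, h2] at h1
    subst h1
    exact hirr _ h
  · intro a b h
    rcases hend a b h with h1 | h1
    · exact Or.inl ⟨h, h1⟩
    · exact Or.inr ⟨hsymm a b h, by rw [← hswap a b h]; exact h1⟩
  · intro _ v
    refine (card_le_card_of_forall_subsingleton (t := univ)
      (fun w j => ∃ h, f ⟨s(v, w), h⟩ = (v, j)) ?_ ?_).trans_eq (Fintype.card_fin s)
    · intro w hw
      obtain ⟨h, h1⟩ := (mem_filter.1 hw).2
      exact ⟨_, mem_univ _, h, Prod.ext h1 rfl⟩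
    · rintro j - w ⟨-, h, hw⟩ w' ⟨-, h', hw'⟩
      have := hf (hw.trans hw'.symm)
      exact Sym2.congr_right.1 (congrArg Subtype.val this)

/-- A regular graph of positive even degree has a `2`-factor, given by a permutation without
cycles of length two. -/
lemma exists_two_factor {V : Type*} [Fintype V] [DecidableEq V] {Γ : V → V → Prop}
    [DecidableRel Γ] (hsymm : ∀ a b, Γ a b → Γ b a) (hirr : ∀ a, ¬ Γ a a) {s : ℕ} (hs : 0 < s)
    (hdeg : ∀ v, #{w | Γ v w} = 2 * s) :
    ∃ σ : Equiv.Perm V, ∀ v, Γ v (σ v) ∧ σ (σ v) ≠ v := by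
  classical
  obtain ⟨D, hD, hΓ, hout⟩ := exists_orientation hsymm hirr fun v => (hdeg v).le
  have hin : ∀ v, s ≤ #{w | D w v} := by
    intro v
    have h1 : #{w | Γ v w} ≤ #{w | D v w} + #{w | D w v} := by
      refine le_trans (card_le_card fun w hw => ?_) (card_union_le _ _)
      have := hΓ v w (mem_filter.1 hw).2
      simpa using this
    have := hout v
    rw [hdeg] at h1
    omega
  obtain ⟨σ, hσ⟩ := exists_perm_of_card_le (E := fun v w => D w v) hs hin hout
  refine ⟨σ, fun v => ⟨hsymm _ _ (hD _ _ (hσ v)).1, fun h => (hD _ _ (hσ v)).2 ?_⟩⟩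
  have := hσ (σ v)
  rwa [h] at this

/-- The effect on colour degrees of giving colour `β` to a regular set of pairs of colour `α`. -/
lemma card_recolour {V : Type*} [Fintype V] {c : V → V → ℕ} {P : V → V → Prop}
    [DecidableRel P] {α β t : ℕ} (hP : ∀ a b, P a b → c a b = α) (ht : ∀ a, #{b | P a b} = t)
    (γ : ℕ) (a : V) :
    #{b | (if P a b then β else c a b) = γ} + (if γ = α then t else 0) =
      #{b | c a b = γ} + (if γ = β then t else 0) := by
  have h : ∀ q : V → Prop, ∀ [DecidablePred q],
      #{b | q b} = #{b | P a b ∧ q b} + #{b | ¬ P a b ∧ q b} := by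
    intro q _
    rw [← card_filter_add_card_filter_not (s := ({b | q b} : Finset V)) (P a), filter_filter,
      filter_filter]
    simp only [and_comm]
  have h1 : #{b | P a b ∧ (if P a b then β else c a b) = γ} = if γ = β then t else 0 := by
    split_ifs with hγ
    · rw [← ht a]
      exact congrArg card (filter_congr fun b _ => ⟨fun h => h.1, fun h => ⟨h, by simp [h, hγ]⟩⟩)
    · rw [card_eq_zero, filter_eq_empty_iff]
      rintro b - ⟨hb, hb'⟩
      rw [if_pos hb] at hb'
      exact hγ hb'.symm
  have h2 : #{b | P a b ∧ c a b = γ} = if γ = α then t else 0 := by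
    split_ifs with hγ
    · rw [← ht a]
      exact congrArg card (filter_congr fun b _ =>
        ⟨fun h => h.1, fun h => ⟨h, by rw [hP _ _ h, hγ]⟩⟩)
    · rw [card_eq_zero, filter_eq_empty_iff]
      rintro b - ⟨hb, hb'⟩
      rw [hP _ _ hb] at hb'
      exact hγ hb'.symm
  have h3 : #{b | ¬ P a b ∧ (if P a b then β else c a b) = γ} = #{b | ¬ P a b ∧ c a b = γ} :=
    congrArg card (filter_congr fun b _ => and_congr_right fun hb => by rw [if_neg hb])
  rw [h, h (fun b => c a b = γ), h1, h2, h3]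
  omega

namespace IsDecomposition

variable {V : Type*} [Fintype V] [DecidableEq V] {d : V → ℕ} {m r : ℕ} {c : V → V → ℕ}

lemma recolour_two_factor (h : IsDecomposition d m (r + 2) c) {σ : Equiv.Perm V}
    (hσ : ∀ v, c v (σ v) = 2 ∧ σ (σ v) ≠ v) :
    IsDecomposition d m r fun a b => if b = σ a ∨ a = σ b then 1 else c a b := by
  have hP : ∀ a b, (b = σ a ∨ a = σ b) → c a b = 2 := by
    rintro a b (rfl | rfl)
    · exact (hσ a).1
    · rw [h.symm]; exact (hσ b).1
  have ht : ∀ a, #{b | b = σ a ∨ a = σ b} = 2 := by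
    intro a
    rw [← card_pair (a := σ a) (b := σ.symm a) fun he => (hσ a).2 (by rw [he]; simp)]
    congr 1
    ext b
    simp [Equiv.eq_symm_apply, eq_comm]
  have hc := card_recolour (β := 1) hP ht
  refine ⟨fun a b => ?_, fun a => ?_, fun a b => ?_, fun v => ?_, fun v => ?_, fun v => ?_,
    fun i hi hi' v => ?_⟩
  · simp only [or_comm, h.symm a b]
  · have : a ≠ σ a := h.ne_of_pos (by simp [hσ])
    simp [this, h.diag]
  · have := h.lt a b
    split_ifs <;> omega
  · have := hc 0 v
    have := h.card_zero v
    simp only [if_false, reduceCtorEq] at *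
    omega
  · have := hc 1 v
    have := h.card_one v
    simp at *
    omega
  · have := hc 2 v
    have := h.card_two v
    simp at *
    omega
  · have := hc i v
    have := h.card_eq_one i hi hi' v
    rw [if_neg (by omega), if_neg (by omega)] at *
    omega

lemma split_matching (h : IsDecomposition d m r c) {τ : V → V} {α s : ℕ}
    (hτ : ∀ v, τ (τ v) = v ∧ c v (τ v) = α) (hα : α = 1 ∧ s = r ∨ α = 2 ∧ s + 1 = r) :
    IsDecomposition d (m + 1) s fun a b => if b = τ a then m + 3 else c a b := by
  have hP : ∀ a b, b = τ a → c a b = α := by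
    rintro a _ rfl
    exact (hτ a).2
  have ht : ∀ a, #{b | b = τ a} = 1 := fun a => by simp [filter_eq']
  have hc := card_recolour (β := m + 3) hP ht
  have hα0 : α ≠ 0 := by omega
  refine ⟨fun a b => ?_, fun a => ?_, fun a b => ?_, fun v => ?_, fun v => ?_, fun v => ?_,
    fun i hi hi' v => ?_⟩
  · have : b = τ a ↔ a = τ b :=
      ⟨fun he => by rw [he, (hτ a).1], fun he => by rw [he, (hτ b).1]⟩
    simp only [this, h.symm a b]
  · have : a ≠ τ a := h.ne_of_pos (by rw [(hτ a).2]; exact hα0)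
    simp [this, h.diag]
  · have := h.lt a b
    split_ifs <;> omega
  · have := hc 0 v
    have := h.card_zero v
    grind
  · have := hc 1 v
    have := h.card_one v
    grind
  · have := hc 2 v
    have := h.card_two v
    grind
  · have := hc i v
    rcases eq_or_ne i (m + 3) with rfl | hne
    · have h0 : #{w | c v w = m + 3} = 0 := by
        rw [card_eq_zero, filter_eq_empty_iff]
        intro w _
        exact (h.lt v w).ne
      grind
    · have := h.card_eq_one i hi (by omega) v
      grind

/-- A matching can be extracted from the regular colour while there are at most three. -/
lemma extract (hV : Even (Fintype.card V)) (hm : m ≤ 3) (h : IsDecomposition d m (r + 1) c) :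
    ∃ c', IsDecomposition d (m + 1) r c' := by
  obtain ⟨σ, hσ⟩ := exists_perm_of_card_le (E := fun a b => c a b = 2) (s := r + 1) (by omega)
    (fun v => (h.card_two v).ge) fun w => by
      have := (h.card_two w).le
      simpa only [h.symm w] using this
  obtain ⟨c', h', τ, hτ⟩ := h.exists_matching_two hV hm hσ
  exact ⟨_, h'.split_matching hτ (Or.inr ⟨rfl, rfl⟩)⟩

/-- Two regular degrees can be traded for a matching when the regular degree is even. -/
lemma trade (hV : Even (Fintype.card V)) (hr : Even r) (h : IsDecomposition d m (r + 2) c) :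
    ∃ c', IsDecomposition d (m + 1) r c' := by
  obtain ⟨s, rfl⟩ := hr
  obtain ⟨σ, hσ⟩ := exists_two_factor (Γ := fun a b => c a b = 2) (s := s + 1)
    (fun a b hab => (h.symm b a).trans hab) (fun a ha => by simp [h.diag] at ha) (by omega)
    fun v => by rw [h.card_two]; omega
  obtain ⟨c', h', τ, hτ⟩ := (h.recolour_two_factor hσ).exists_matching_one hV (σ := σ) (by simp)
  exact ⟨_, h'.split_matching hτ (Or.inl ⟨rfl, rfl⟩)⟩

end IsDecomposition

end Factors

section Packing

open Finset

/-- The number of ordered pairs on which two `0`-`1` matrices both take the value `true`. -/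
def overlap {V : Type*} [Fintype V] (c e : V → V → Bool) : ℤ :=
  ∑ p : V × V, if c p.1 p.2 ∧ e p.1 p.2 then 1 else 0

lemma overlap_comm {V : Type*} [Fintype V] (c e : V → V → Bool) : overlap c e = overlap e c := by
  simp only [overlap, and_comm]

/-- A simple graph, as a symmetric Boolean matrix, with degree sequence `d`. -/
structure Realizes {V : Type*} [Fintype V] (c : V → V → Bool) (d : V → ℕ) : Prop where
  symm : ∀ a b, c a b = c b a
  diag : ∀ a, c a a = false
  card : ∀ v, #{w | c v w = true} = d v

lemma Realizes.exists_overlap_lt {V : Type*} [Fintype V] [DecidableEq V] {c e : V → V → Bool}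
    {d : V → ℕ} (hc : Realizes c d) (he : ∀ a b, e a b = e b a) {x w u v : V} (hxw : x ≠ w)
    (huv : u ≠ v) (hxu : x ≠ u) (hxv : x ≠ v) (hwu : w ≠ u) (hwv : w ≠ v)
    (h1 : c u x = false) (h2 : c v x = true) (h3 : c u w = true) (h4 : c v w = false)
    (h5 : e x u = true) (h6 : e x v = false) (h7 : e w u = true → e w v = true) :
    ∃ c', Realizes c' d ∧ overlap c e < overlap c' e := by
  have hu : u ∉ ({x, w} : Finset V) := by simp [hxu.symm, hwu.symm]
  have hv : v ∉ ({x, w} : Finset V) := by simp [hxv.symm, hwv.symm]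
  refine ⟨switch c u v {x, w}, ⟨switch_symm hc.symm hu hv,
    fun a => (switch_self hu hv a).trans (hc.diag a), fun a => ?_⟩, ?_⟩
  · rw [← hc.card]
    refine card_switch hu hv (fun γ => ?_) true a
    rw [filter_insert, filter_insert, filter_singleton, filter_singleton, h1, h2, h3, h4]
    cases γ <;> simp
  · rw [← sub_pos, overlap, overlap, ← sum_sub_distrib]
    have hsw : ∀ a, a ≠ u → a ≠ v → Equiv.swap u v a = a := fun a => Equiv.swap_apply_of_ne_of_ne
    rw [← sum_subset (subset_univ ({(x, u), (x, v), (w, u), (w, v), (u, x), (v, x), (u, w),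
      (v, w)} : Finset (V × V)))]
    · have hu1 := he u x
      have hu2 := he v x
      have hu3 := he u w
      have hu4 := he v w
      have hc1 := hc.symm x u
      have hc2 := hc.symm x v
      have hc3 := hc.symm w u
      have hc4 := hc.symm w v
      rw [h5] at hu1
      rw [h6] at hu2
      rw [h1] at hc1
      rw [h2] at hc2
      rw [h3] at hc3
      rw [h4] at hc4
      rw [sum_insert, sum_insert, sum_insert, sum_insert, sum_insert, sum_insert, sum_pair]
      · cases he1 : e w u <;> cases he2 : e w v <;> simp [switch, *] at h7 ⊢
      all_goals simp [*, huv.symm, hxu.symm, hxv.symm, hwu.symm, hwv.symm]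
    · rintro ⟨a, b⟩ - hab
      simp only [mem_insert, mem_singleton, Prod.mk.injEq, not_or, not_and] at hab
      have : switch c u v {x, w} a b = c a b := by
        unfold switch
        split_ifs with hb ha
        · rw [mem_insert, mem_singleton] at hb
          rw [hsw a] <;> grind
        · rw [mem_insert, mem_singleton] at ha
          rw [hsw b] <;> grind
        · rfl
      simp [this]

/-- Two realizations whose degrees differ by the constant `k` can be nested, unless their overlap
can be increased. -/
lemma exists_overlap_lt {V : Type*} [Fintype V] [DecidableEq V] {c e : V → V → Bool}
    {d : V → ℕ} {k : ℕ} (hdk : ∀ v, k ≤ d v) (hc : Realizes c d)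
    (he : Realizes e fun v => d v - k) {x y : V} (hexy : e x y = true) (hcxy : c x y = false) :
    ∃ c' e', Realizes c' d ∧ Realizes e' (fun v => d v - k) ∧ overlap c e < overlap c' e' := by
  obtain ⟨z, hcxz, hexz⟩ : ∃ z, c x z = true ∧ e x z = false := by
    by_contra! h
    have hlt : #{w | c x w = true} < #{w | e x w = true} := by
      refine card_lt_card ⟨fun w hw => ?_, fun hs => ?_⟩
      · simpa using h w (mem_filter.1 hw).2
      · have := @hs y (by simpa using hexy)
        simp [hcxy] at this
    rw [hc.card, he.card] at hlt
    omega
  have hxy : x ≠ y := by rintro rfl; simp [he.diag] at hexy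
  have hxz : x ≠ z := by rintro rfl; simp [hc.diag] at hcxz
  have hyz : y ≠ z := by rintro rfl; simp [hexy] at hexz
  let δ : V → ℤ := fun w => ((if e z w then 1 else 0) - (if c z w then 1 else 0)) -
    ((if e y w then 1 else 0) - (if c y w then 1 else 0))
  have hsum : ∑ w, δ w = 0 := by
    have hcs : ∀ v, (∑ w, if c v w then (1 : ℤ) else 0) = d v := fun v => by
      rw [sum_boole, ← hc.card v]
    have hes : ∀ v, (∑ w, if e v w then (1 : ℤ) else 0) = d v - k := fun v => by
      rw [sum_boole, he.card v, Nat.cast_sub (hdk v)]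
    simp only [δ, sum_sub_distrib, hcs, hes]
    ring
  obtain ⟨w, hw, hδ⟩ : ∃ w ∈ ({x, y, z} : Finset V)ᶜ, 0 < δ w := by
    by_contra! h
    have h1 := sum_nonpos h
    rw [← sum_add_sum_compl ({x, y, z} : Finset V)] at hsum
    have h2 : ∑ w ∈ ({x, y, z} : Finset V), δ w = -2 := by
      rw [sum_insert (by simp [hxy, hxz]), sum_pair hyz]
      simp only [δ, hc.diag, he.diag, hc.symm z, he.symm z, hc.symm y x, he.symm y x, hcxy, hexy,
        hcxz, hexz]
      simp
    omega
  simp only [mem_compl, mem_insert, mem_singleton, not_or] at hw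
  obtain ⟨hwx, hwy, hwz⟩ := hw
  by_cases hcase : c y w = true ∧ c z w = false
  · obtain ⟨c', h1, h2⟩ := hc.exists_overlap_lt he.symm (x := x) (w := w) (u := y) (v := z)
      (Ne.symm hwx) hyz hxy hxz hwy hwz (by rw [hc.symm, hcxy])
        (by rw [hc.symm, hcxz]) hcase.1 hcase.2
      hexy hexz (fun h => by
        rw [he.symm] at h ⊢
        by_contra h'
        simp [δ, hcase, h, h'] at hδ)
    exact ⟨c', e, h1, he, h2⟩
  · have key : e z w = true ∧ e y w = false ∧ c z w = c y w := by
      revert hcase hδ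
      simp only [δ]
      cases e z w <;> cases e y w <;> cases c z w <;> cases c y w <;> simp
    obtain ⟨e', h1, h2⟩ := he.exists_overlap_lt hc.symm (x := x) (w := w) (u := z) (v := y)
      (Ne.symm hwx) hyz.symm hxz hxy hwz hwy (by rw [he.symm, hexz]) (by rw [he.symm, hexy]) key.1
      key.2.1 hcxz hcxy (fun h => by rw [hc.symm, ← key.2.2, hc.symm, h])
    refine ⟨c, e', hc, h1, ?_⟩
    rwa [overlap_comm c e', overlap_comm c e]

/-- Theorem of Kundu: if `d` and `d - k` are both realizable, then some realization of `d` contains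
a `k`-regular spanning subgraph. -/
lemma exists_isDecomposition {V : Type*} [Fintype V] [DecidableEq V] {c e : V → V → Bool}
    {d : V → ℕ} {k : ℕ} (hdk : ∀ v, k ≤ d v) (hc : Realizes c d)
    (he : Realizes e fun v => d v - k) : ∃ f, IsDecomposition d 0 k f := by
  classical
  obtain ⟨⟨c, e⟩, hmem, hmax⟩ := exists_max_image
    ({p | Realizes p.1 d ∧ Realizes p.2 fun v => d v - k} :
      Finset ((V → V → Bool) × (V → V → Bool))) (fun p => overlap p.1 p.2)
    ⟨(c, e), by simp [hc, he]⟩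
  clear hc he
  have hc : Realizes c d := (mem_filter.1 hmem).2.1
  have he : Realizes e fun v => d v - k := (mem_filter.1 hmem).2.2
  have hle : ∀ a b, e a b = true → c a b = true := by
    intro a b hab
    by_contra hcab
    obtain ⟨c', e', h1, h2, h3⟩ := exists_overlap_lt hdk hc he hab (by simpa using hcab)
    exact (hmax (c', e') (by simp [h1, h2])).not_gt h3
  have hcomp : ∀ v, #{w | c v w = true} + #{w | ¬ c v w = true} = Fintype.card V := fun v => by
    rw [card_filter_add_card_filter_not, card_univ]
  have hsplit : ∀ v, #{w | e v w = true} + #{w | c v w = true ∧ ¬ e v w = true} =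
      #{w | c v w = true} := fun v => by
    rw [← card_filter_add_card_filter_not (s := ({w | c v w = true} : Finset V))
      (fun w => e v w = true), filter_filter, filter_filter]
    congr 2
    exact filter_congr fun w _ => ⟨fun h => ⟨hle v w h, h⟩, fun h => h.2⟩
  refine ⟨fun a b => if c a b then (if e a b then 1 else 2) else 0, fun a b => ?_, fun a => ?_,
    fun a b => ?_, fun v => ?_, fun v => ?_, fun v => ?_, fun i hi hi' => by omega⟩
  · simp only [hc.symm a b, he.symm a b]
  · simp [hc.diag]
  · split_ifs <;> omega
  · have h := hcomp v
    rw [hc.card] at h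
    rw [← h, add_comm]
    congr 2
    exact filter_congr fun w _ => by split_ifs with h1 h2 <;> simp [h1]
  · have h := he.card v
    have : #{w | (if c v w then (if e v w then 1 else 2) else 0) = 1} = #{w | e v w = true} :=
      congrArg card (filter_congr fun w _ => by
        have := hle v w
        revert this
        cases c v w <;> cases e v w <;> simp)
    rw [this, h]
    have := hdk v
    omega
  · have h := hsplit v
    have : #{w | (if c v w then (if e v w then 1 else 2) else 0) = 2} =
        #{w | c v w = true ∧ ¬ e v w = true} := congrArg card (filter_congr fun w _ => by
      split_ifs with h1 h2 <;> simp_all)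
    rw [this]
    rw [hc.card, he.card] at h
    have := hdk v
    omega

end Packing

section Assembly

open Finset

namespace IsDecomposition

variable {V : Type*} [Fintype V] {d : V → ℕ} {m r : ℕ} {c : V → V → ℕ}

lemma iterate_extract [DecidableEq V] (hV : Even (Fintype.card V)) (j : ℕ) (hm : m + j ≤ 4)
    (h : IsDecomposition d m (r + j) c) : ∃ c', IsDecomposition d (m + j) r c' := by
  induction j generalizing r with
  | zero => exact ⟨c, h⟩
  | succ j ih =>
    obtain ⟨c', h'⟩ := ih (r := r + 1) (by omega) (by rwa [Nat.add_right_comm, Nat.add_assoc])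
    exact h'.extract hV (show m + j ≤ 3 by omega)

lemma iterate_trade [DecidableEq V] (hV : Even (Fintype.card V)) (j : ℕ)
    (h : IsDecomposition d m (2 * j) c) :
    ∃ c', IsDecomposition d (m + j) 0 c' := by
  induction j generalizing m c with
  | zero => exact ⟨c, h⟩
  | succ j ih =>
    obtain ⟨c', h'⟩ := h.trade hV (even_two_mul j)
    obtain ⟨c'', h''⟩ := ih h'
    exact ⟨c'', by rwa [Nat.add_right_comm, Nat.add_assoc] at h''⟩

lemma exists_half_add_two [DecidableEq V] {k : ℕ} (hV : Even (Fintype.card V)) (hk : 4 ≤ k)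
    (h : IsDecomposition d 0 k c) : ∃ c', IsDecomposition d (k / 2 + 2) 0 c' := by
  obtain ⟨q, rfl | rfl⟩ := Nat.even_or_odd' k
  · obtain ⟨s, rfl⟩ := Nat.exists_eq_add_of_le (show 2 ≤ q by omega)
    obtain ⟨c₁, h₁⟩ := iterate_extract (m := 0) (r := 2 * s) hV 4 le_rfl
      (by rwa [show 2 * (2 + s) = 2 * s + 4 by omega] at h)
    obtain ⟨c₂, h₂⟩ := h₁.iterate_trade hV
    exact ⟨c₂, by rwa [show 2 * (2 + s) / 2 + 2 = 0 + 4 + s by omega]⟩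
  · obtain ⟨s, rfl⟩ := Nat.exists_eq_add_of_le (show 1 ≤ q by omega)
    obtain ⟨c₁, h₁⟩ := iterate_extract (m := 0) (r := 2 * s) hV 3 (by omega)
      (by rwa [show 2 * (1 + s) + 1 = 2 * s + 3 by omega] at h)
    obtain ⟨c₂, h₂⟩ := h₁.iterate_trade hV
    exact ⟨c₂, by rwa [show (2 * (1 + s) + 1) / 2 + 2 = 0 + 3 + s by omega]⟩

/-- The graph of the pairs whose colour satisfies `p`. -/
def graph (h : IsDecomposition d m r c) (p : ℕ → Prop) (hp : ¬ p 0) : SimpleGraph V where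
  Adj a b := p (c a b)
  symm := ⟨fun a b hab => by rwa [h.symm]⟩
  loopless := ⟨fun a ha => hp (by rwa [h.diag] at ha)⟩

lemma ncard_neighborSet_graph (h : IsDecomposition d m r c) (p : ℕ → Prop) [DecidablePred p]
    (hp : ¬ p 0) (v : V) : ((h.graph p hp).neighborSet v).ncard = #{w | p (c v w)} := by
  rw [← Set.ncard_coe_finset]
  congr 1
  ext w
  simp [graph]

end IsDecomposition

lemma IsGraphic.exists_realizes {n : ℕ} {d : Fin n → ℕ} (h : IsGraphic d) :
    ∃ c, Realizes c d := by
  classical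
  obtain ⟨G, hG⟩ := h
  refine ⟨fun a b => decide (G.Adj a b), fun a b => by simp [G.adj_comm], by simp, fun v => ?_⟩
  rw [← hG, ← Set.ncard_coe_finset]
  congr 1
  ext w
  simp

end Assembly

/-- If `π` and `π - k` are graphic of even length (and `k ≥ 4`), then `π`
has a realization containing `⌊k/2⌋ + 2` pairwise edge-disjoint perfect matchings. -/
theorem stmt11 {n : ℕ} (hn : Even n) (d : Fin n → ℕ) (k : ℕ) (hk : 4 ≤ k)
    (hdk : ∀ i, k ≤ d i)
    (hd : IsGraphic d) (hd' : IsGraphic (fun i => d i - k)) :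
    ∃ G : SimpleGraph (Fin n), (∀ v, (G.neighborSet v).ncard = d v) ∧
      ∃ M : Fin (k / 2 + 2) → SimpleGraph (Fin n),
        (∀ i, M i ≤ G ∧ ∀ v, ((M i).neighborSet v).ncard = 1) ∧
        (∀ i j, i ≠ j → Disjoint (M i).edgeSet (M j).edgeSet) := by
  have hV : Even (Fintype.card (Fin n)) := by rwa [Fintype.card_fin]
  obtain ⟨e, he⟩ := hd.exists_realizes
  obtain ⟨e', he'⟩ := hd'.exists_realizes
  obtain ⟨c₀, h₀⟩ := exists_isDecomposition hdk he he'
  obtain ⟨c, h⟩ := h₀.exists_half_add_two hV hk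
  refine ⟨h.graph (· ≠ 0) (by simp), fun v => ?_,
    fun i => h.graph (· = i + 3) (by omega), fun i => ⟨fun a b hab => ?_, fun v => ?_⟩,
    fun i j hij => ?_⟩
  · rw [h.ncard_neighborSet_graph]
    have h1 := h.card_zero v
    have h2 := Finset.card_filter_add_card_filter_not (s := Finset.univ) fun w => c v w = 0
    rw [Finset.card_univ] at h2
    simp only [ne_eq]
    omega
  · have hab' : c a b = i + 3 := hab
    have : c a b ≠ 0 := by omega
    exact this
  · rw [h.ncard_neighborSet_graph]
    exact h.card_eq_one _ (by omega) (by omega) v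
  · refine Set.disjoint_left.2 fun e hi hj => hij ?_
    induction e with
    | _ a b =>
      have h1 : c a b = i + 3 := hi
      have h2 : c a b = j + 3 := hj
      exact Fin.ext (by omega)
end
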